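/- Let p > 3 be prime with p ≢ 1 (mod 12), and E an elliptic curve over F_p with j(E) ≠ 0, 1728. Then with q = p², the trace a(E/F_p) satisfies a(E/F_p)² = a(E/F_{p²}) + 2p, where a(E/F_{p²}) is given by the hypergeometric formula −p²·T^{(p²−1)/12}(1728/Δ(E))·₂F₁(T^{(p²−1)/12}, T^{(p²−1)/12}; T^{2(p²−1)/3} | j(E)/1728)_{p²} for T a generator of the character group of F_{p²}^*. -/

import Mathlib

open Finset

/-- The canonical additive character `θ(α) = e^{2πi·tr(α)/p}` of `F = F_q`, `q = p^e`. -/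
noncomputable def theta (p : ℕ) (F : Type) [Field F] [Fintype F] [Algebra (ZMod p) F]
    (α : F) : ℂ :=
  Complex.exp (2 * Real.pi * Complex.I * ((Algebra.trace (ZMod p) F α).val : ℂ) / p)

/-- The Gauss sum `G_m = ∑_{x ∈ F_q} T^m(x) θ(x)` (recall `T^m (0) = 0` for `T^m` nontrivial,
and characters are extended by `χ(0) = 0`). -/
noncomputable def gaussT (p : ℕ) (F : Type) [Field F] [Fintype F] [Algebra (ZMod p) F]
    (T : MulChar F ℂ) (m : ℤ) : ℂ :=
  ∑ x : F, (T ^ m) x * theta p F x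

/-- The normalized Jacobi sum `binom(A,B) = (B(-1)/q) · J(A, B̄)`. -/
noncomputable def binomC (F : Type) [Field F] [Fintype F] (A B : MulChar F ℂ) : ℂ :=
  B (-1) / (Fintype.card F : ℂ) * jacobiSum A B⁻¹

/-- Greene's Gaussian hypergeometric series `₂F₁(A,B;C|x)_q`, the sum over all
multiplicative characters `χ = T^m` of `F_q^*`, written via a generator `T` of the
character group. -/
noncomputable def hypF21 (F : Type) [Field F] [Fintype F] (T : MulChar F ℂ)
    (A B C : MulChar F ℂ) (x : F) : ℂ :=
  (Fintype.card F : ℂ) / ((Fintype.card F : ℂ) - 1) *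
    ∑ m ∈ Finset.range (Fintype.card F - 1),
      binomC F (A * T ^ m) (T ^ m) * binomC F (B * T ^ m) (C * T ^ m) * (T ^ m) x

theorem Fintype.sum_eq_zero_add_sum_units {K M : Type*} [Field K] [Fintype K] [DecidableEq K]
    [AddCommMonoid M]
    (f : K → M) : ∑ x, f x = f 0 + ∑ u : Kˣ, f u := by
  rw [Fintype.sum_eq_add_sum_compl 0 f]
  congr 1
  refine (Finset.sum_bij (fun (u : Kˣ) _ => (u : K)) ?_ ?_ ?_ ?_).symm
  · simp
  · intro a _ b _ h; exact Units.ext h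
  · intro b hb
    exact ⟨Units.mk0 b (by simpa using hb), mem_univ _, rfl⟩
  · simp

theorem gaussSum_eq_sum_units {K : Type*} [Field K] [Fintype K] [DecidableEq K] (χ : MulChar K ℂ)
    (θ : AddChar K ℂ) : gaussSum χ θ = ∑ u : Kˣ, χ u * θ u := by
  rw [gaussSum, Fintype.sum_eq_zero_add_sum_units, MulChar.map_zero, zero_mul, zero_add]

theorem MulChar.card_eq_card_sub_one {K : Type*} [Field K] [Fintype K] [Fintype (MulChar K ℂ)] :
    (Fintype.card (MulChar K ℂ) : ℂ) = Fintype.card K - 1 := by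
  rw [← Nat.card_eq_fintype_card, MulChar.card_eq_card_units_of_hasEnoughRootsOfUnity,
    Nat.card_units, Nat.card_eq_fintype_card, Nat.cast_sub Fintype.card_pos, Nat.cast_one]

theorem MulChar.sum_apply_units {K : Type*} [Field K] [Fintype K] [Fintype (MulChar K ℂ)]
    [DecidableEq K] (a : Kˣ) :
    ∑ χ : MulChar K ℂ, χ a = if a = 1 then (Fintype.card K : ℂ) - 1 else 0 := by
  split_ifs with h
  · simp [h, MulChar.card_eq_card_sub_one]
  · obtain ⟨ψ, hψ⟩ := MulChar.exists_apply_ne_one_of_hasEnoughRootsOfUnity K ℂ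
      (a := (a : K)) (by simpa using h)
    have : ψ a * ∑ χ : MulChar K ℂ, χ a = ∑ χ : MulChar K ℂ, χ a := by
      rw [mul_sum]
      exact Fintype.sum_equiv (Equiv.mulLeft ψ) _ _ fun χ => by simp
    have h2 : (ψ a - 1) * ∑ χ : MulChar K ℂ, χ a = 0 := by rw [sub_mul, this]; ring
    exact (mul_eq_zero.mp h2).resolve_left (sub_ne_zero.mpr hψ)

theorem MulChar.eq_of_sum_units_eq {K : Type*} [Field K] [Fintype K] [DecidableEq K] {f g : Kˣ → ℂ}
    (h : ∀ χ : MulChar K ℂ, ∑ u : Kˣ, χ u * f u = ∑ u : Kˣ, χ u * g u) (c : Kˣ) :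
    f c = g c := by
  have := Fintype.ofFinite (MulChar K ℂ)
  have hq : (Fintype.card K : ℂ) - 1 ≠ 0 := by
    rw [sub_ne_zero]
    exact_mod_cast (Fintype.one_lt_card (α := K)).ne'
  have key : ∀ f : Kˣ → ℂ, ∑ χ : MulChar K ℂ, χ (c⁻¹ : Kˣ) * ∑ u : Kˣ, χ u * f u
      = (Fintype.card K - 1) * f c := by
    intro f
    simp_rw [mul_sum, ← mul_assoc, ← map_mul, ← Units.val_mul]
    rw [sum_comm]
    simp_rw [← sum_mul, MulChar.sum_apply_units, ite_mul, zero_mul]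
    rw [Finset.sum_eq_single c]
    · simp
    · intro b _ hb
      rw [if_neg]
      rw [inv_mul_eq_one]; exact hb.symm
    · simp
  have := key f
  simp_rw [h, key g] at this
  exact (mul_left_cancel₀ hq this).symm

theorem Complex.eq_of_sum_mul_star_eq {ι : Type*} [Fintype ι] [DecidableEq ι] {L R : ι → ℂ}
    {B : ℝ} (hL : ∀ i, ‖L i‖ ^ 2 ≤ B) (hR : ∀ i, ‖R i‖ ^ 2 ≤ B) {E : Finset ι}
    (hE : ∀ i ∈ E, L i = R i)
    (hsum : ∑ i, L i * star (R i) = ∑ i ∈ E, (‖R i‖ ^ 2 : ℂ) + #Eᶜ * B) (i : ι) :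
    L i = R i := by
  have hEsum : ∑ i ∈ E, L i * star (R i) = ∑ i ∈ E, (‖R i‖ ^ 2 : ℂ) :=
    sum_congr rfl fun i hi => by
      rw [hE i hi, Complex.star_def, Complex.mul_conj, Complex.normSq_eq_norm_sq]
      push_cast
      rfl
  rw [← sum_add_sum_compl E, hEsum, add_right_inj] at hsum
  have hre : ∑ i ∈ Eᶜ, (L i * star (R i)).re = #Eᶜ * B := by
    have := congrArg Complex.re hsum
    simpa using this
  have hdist : ∀ i, ‖L i - R i‖ ^ 2 = ‖L i‖ ^ 2 + ‖R i‖ ^ 2 - 2 * (L i * star (R i)).re := by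
    intro i
    rw [← Complex.normSq_eq_norm_sq, ← Complex.normSq_eq_norm_sq, ← Complex.normSq_eq_norm_sq,
      Complex.normSq_sub]
    rfl
  have hle : ∑ i ∈ Eᶜ, ‖L i - R i‖ ^ 2 ≤ 0 := by
    calc ∑ i ∈ Eᶜ, ‖L i - R i‖ ^ 2 ≤ ∑ i ∈ Eᶜ, (2 * B - 2 * (L i * star (R i)).re) :=
          sum_le_sum fun i _ => by rw [hdist]; linarith [hL i, hR i]
      _ = 0 := by
          rw [sum_sub_distrib, ← mul_sum, ← mul_sum, hre, sum_const, nsmul_eq_mul]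
          ring
  by_cases hi : i ∈ E
  · exact hE i hi
  · have h0 := (sum_eq_zero_iff_of_nonneg (fun i _ => sq_nonneg ‖L i - R i‖)).mp
      (le_antisymm hle (sum_nonneg fun i _ => sq_nonneg _)) i (by simpa using hi)
    simpa [sub_eq_zero] using h0

theorem gaussSum_mul_star_self {K : Type*} [Field K] [Fintype K] {χ : MulChar K ℂ}
    {θ : AddChar K ℂ} (hθ : θ.IsPrimitive) (hχ : χ ≠ 1) :
    gaussSum χ θ * star (gaussSum χ θ) = Fintype.card K := by
  rw [star_gaussSum_eq, gaussSum_mul_gaussSum_eq_card hχ hθ]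

theorem gaussSum_mul_gaussSum_inv {K : Type*} [Field K] [Fintype K] {χ : MulChar K ℂ}
    {θ : AddChar K ℂ} (hθ : θ.IsPrimitive) (hχ : χ ≠ 1) :
    gaussSum χ θ * gaussSum χ⁻¹ θ = χ (-1) * Fintype.card K := by
  rw [← gaussSum_mul_gaussSum_eq_card hχ hθ, ← mul_gaussSum_inv_eq_gaussSum χ⁻¹ θ,
    MulChar.inv_apply']
  norm_num
  ring

theorem AddChar.IsPrimitive.gaussSum_one {K : Type*} [Field K] [Fintype K]
    {θ : AddChar K ℂ} (hθ : θ.IsPrimitive) : gaussSum (1 : MulChar K ℂ) θ = -1 := by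
  apply gaussSum_one_left
  rintro rfl
  exact hθ one_ne_zero (by ext; simp)

theorem normSq_gaussSum {K : Type*} [Field K] [Fintype K] {χ : MulChar K ℂ}
    {θ : AddChar K ℂ} (hθ : θ.IsPrimitive) (hχ : χ ≠ 1) :
    ‖gaussSum χ θ‖ ^ 2 = Fintype.card K := by
  have := gaussSum_mul_star_self hθ hχ
  rw [Complex.star_def, Complex.mul_conj, Complex.normSq_eq_norm_sq] at this
  exact_mod_cast this

theorem normSq_gaussSum_le {K : Type*} [Field K] [Fintype K] (χ : MulChar K ℂ)
    {θ : AddChar K ℂ} (hθ : θ.IsPrimitive) :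
    ‖gaussSum χ θ‖ ^ 2 ≤ Fintype.card K := by
  by_cases h : χ = 1
  · rw [h, hθ.gaussSum_one]
    simp only [norm_neg, norm_one, one_pow]
    exact_mod_cast Fintype.card_pos
  · exact (normSq_gaussSum hθ h).le

theorem MulChar.norm_apply {K : Type*} [Field K] [Fintype K] (χ : MulChar K ℂ) {x : K}
    (hx : x ≠ 0) : ‖χ x‖ = 1 := by
  classical
  exact Complex.norm_eq_one_of_mem_rootsOfUnity (χ.apply_mem_rootsOfUnity (Units.mk0 x hx))

theorem AddChar.IsPrimitive.sum_units_mul {K : Type*} [Field K] [Fintype K] [DecidableEq K]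
    {θ : AddChar K ℂ} (hθ : θ.IsPrimitive) (b : K) :
    ∑ w : Kˣ, θ (w * b) = (if b = 0 then (Fintype.card K : ℂ) else 0) - 1 := by
  have h1 := AddChar.sum_mulShift b hθ
  rw [Fintype.sum_eq_zero_add_sum_units] at h1
  rw [eq_sub_iff_add_eq, add_comm]
  simpa using h1

theorem sum_units_mulChar_mul_addChar {K : Type*} [Field K] [Fintype K] [DecidableEq K]
    (χ : MulChar K ℂ) (θ : AddChar K ℂ) (b : Kˣ) :
    ∑ w : Kˣ, χ w * θ (w * b) = χ⁻¹ b * gaussSum χ θ := by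
  rw [gaussSum_eq_sum_units, mul_sum]
  refine Fintype.sum_equiv (Equiv.mulRight b) _ _ fun w => ?_
  rw [MulChar.inv_apply_eq_inv']
  have : χ b ≠ 0 := MulChar.apply_ne_zero_iff.mpr b.isUnit
  simp
  field_simp

theorem gaussSum_eq_mul_sum_units {K : Type*} [Field K] [Fintype K] [DecidableEq K]
    (χ : MulChar K ℂ) (θ : AddChar K ℂ) (w : Kˣ) :
    gaussSum χ θ = χ w * ∑ x : Kˣ, χ x * θ (w * x) := by
  rw [← gaussSum_mulShift χ θ w, gaussSum_eq_sum_units]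
  rfl

theorem MulChar.sum_sum_apply_mul {K : Type*} [Field K] [Fintype K] [DecidableEq K]
    [Fintype (MulChar K ℂ)] (c : Kˣ) (F : Kˣ → ℂ) :
    ∑ χ : MulChar K ℂ, ∑ x : Kˣ, χ (c * x) * F x = (Fintype.card K - 1) * F c⁻¹ := by
  simp_rw [← Units.val_mul]
  rw [sum_comm]
  simp_rw [← sum_mul, MulChar.sum_apply_units, ite_mul, zero_mul]
  rw [Finset.sum_eq_single c⁻¹]
  · simp
  · intro b _ hb
    rw [if_neg]
    rw [mul_eq_one_iff_inv_eq]; exact hb.symm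
  · simp

theorem star_gaussSum_pow {K : Type*} [Field K] [Fintype K] [DecidableEq K]
    (χ : MulChar K ℂ) (θ : AddChar K ℂ) (n : ℕ) :
    star (gaussSum (χ ^ n) θ) = ∑ w : Kˣ, (χ w)⁻¹ ^ n * θ (-w) := by
  rw [star_gaussSum_eq, gaussSum_eq_sum_units]
  refine sum_congr rfl fun w _ => ?_
  rw [MulChar.inv_apply_eq_inv', MulChar.pow_apply_coe, AddChar.inv_apply, inv_pow]

theorem MulChar.apply_pow_eq_one {K : Type*} [Field K] {χ : MulChar K ℂ} {n : ℕ} (h : χ ^ n = 1)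
    {x : K} (hx : x ≠ 0) : χ (x ^ n) = 1 := by
  have := MulChar.pow_apply_coe χ n (Units.mk0 x hx)
  rw [h, MulChar.one_apply_coe] at this
  simpa using this.symm

theorem sum_gaussSum_duplication {K : Type*} [Field K] [Fintype K] [Fintype (MulChar K ℂ)]
    (h2 : (2 : K) ≠ 0) {η : MulChar K ℂ} (hη : η ≠ 1) (hη2 : η ^ 2 = 1)
    (θ : AddChar K ℂ) :
    ∑ χ : MulChar K ℂ, χ 4 * gaussSum χ θ * gaussSum (χ * η) θ * star (gaussSum (χ ^ 2) θ) =
      (Fintype.card K - 1) * (Fintype.card K - 2) * gaussSum η θ := by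
  classical
  have h4 : (4 : K) ≠ 0 := by
    have : (4 : K) = 2 * 2 := by norm_num
    rw [this]; exact mul_ne_zero h2 h2
  set k : Kˣ := Units.mk0 4 h4 with hk
  have hkv : (k : K) = 4 := rfl
  have step : ∀ χ : MulChar K ℂ,
      χ 4 * gaussSum χ θ * gaussSum (χ * η) θ * star (gaussSum (χ ^ 2) θ) =
      ∑ w : Kˣ, ∑ y : Kˣ, ∑ x : Kˣ, χ ((k * y : Kˣ) * x) *
        (η w * η y * θ (w * (x + y - 1))) := by
    intro χ
    rw [star_gaussSum_pow, mul_sum]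
    refine sum_congr rfl fun w _ => ?_
    rw [gaussSum_eq_mul_sum_units χ θ w, gaussSum_eq_mul_sum_units (χ * η) θ w]
    have hw : χ w ≠ 0 := MulChar.apply_ne_zero_iff.mpr w.isUnit
    have : χ 4 * (χ w * ∑ x : Kˣ, χ x * θ (w * x)) *
        ((χ * η) w * ∑ x : Kˣ, (χ * η) x * θ (w * x)) * ((χ w)⁻¹ ^ 2 * θ (-w)) =
        (∑ x : Kˣ, (χ * η) x * θ (w * x)) * (∑ x : Kˣ, χ x * θ (w * x)) *
          (χ 4 * η w * θ (-w)) := by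
      rw [MulChar.mul_apply]
      field_simp
    rw [this, sum_mul_sum, sum_mul]
    refine sum_congr rfl fun y _ => ?_
    rw [sum_mul]
    refine sum_congr rfl fun x _ => ?_
    rw [show (w : K) * (x + y - 1) = w * x + w * y + -w by ring, AddChar.map_add_eq_mul,
      AddChar.map_add_eq_mul, MulChar.mul_apply, Units.val_mul, map_mul χ, map_mul χ, hkv]
    ring
  have key : ∀ y : Kˣ, ∑ w : Kˣ, η w * η y * θ (w * (((k * y)⁻¹ : Kˣ) + y - 1)) =
      if (y : K) = 2⁻¹ then 0 else gaussSum η θ := by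
    intro y
    have hb : (((k * y)⁻¹ : Kˣ) + y - 1 : K) = (y - 2⁻¹) ^ 2 / y := by
      have hy := y.ne_zero
      rw [Units.val_inv_eq_inv_val, Units.val_mul, hkv]
      field_simp
      ring
    rw [hb]
    split_ifs with h
    · rw [h]
      have : ∑ w : Kˣ, η w = 0 := by
        have := MulChar.sum_eq_zero_of_ne_one hη
        rwa [Fintype.sum_eq_zero_add_sum_units, MulChar.map_zero, zero_add] at this
      simp [← sum_mul, this]
    · have ht : (y - 2⁻¹ : K) ≠ 0 := sub_ne_zero.mpr h
      have hb0 : (y - 2⁻¹ : K) ^ 2 / y ≠ 0 := div_ne_zero (pow_ne_zero _ ht) y.ne_zero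
      have e := sum_units_mulChar_mul_addChar η θ (Units.mk0 _ hb0)
      rw [Units.val_mk0] at e
      simp_rw [mul_comm (η _) (η y), mul_assoc]
      rw [← mul_sum, e, ← mul_assoc, MulChar.inv_apply', ← map_mul,
        show (y : K) * ((y - 2⁻¹ : K) ^ 2 / y)⁻¹ = (y / (y - 2⁻¹)) ^ 2 by field_simp,
        MulChar.apply_pow_eq_one hη2 (div_ne_zero y.ne_zero ht), one_mul]
  simp_rw [step]
  rw [sum_comm]
  have orth : ∀ w : Kˣ, ∑ χ : MulChar K ℂ, ∑ y : Kˣ, ∑ x : Kˣ, χ ((k * y : Kˣ) * x) *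
      (η w * η y * θ (w * (x + y - 1))) = ∑ y : Kˣ, (Fintype.card K - 1) *
        (η w * η y * θ (w * (((k * y)⁻¹ : Kˣ) + y - 1))) := by
    intro w
    rw [sum_comm]
    exact sum_congr rfl fun y _ => MulChar.sum_sum_apply_mul (k * y)
      fun x => η w * η y * θ (w * (x + y - 1))
  simp_rw [orth]
  rw [sum_comm]
  simp_rw [← mul_sum, key]
  rw [mul_assoc]
  congr 1
  have h := Fintype.sum_eq_zero_add_sum_units
    (fun y : K => if y = 2⁻¹ then gaussSum η θ else 0)
  have h3 : ∑ y : Kˣ, ((if (y : K) = 2⁻¹ then 0 else gaussSum η θ) +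
      (if (y : K) = 2⁻¹ then gaussSum η θ else 0)) = (Fintype.card K - 1) * gaussSum η θ := by
    have : ∀ y : Kˣ, ((if (y : K) = 2⁻¹ then 0 else gaussSum η θ) +
      (if (y : K) = 2⁻¹ then gaussSum η θ else 0)) = gaussSum η θ := by
      intro y; split_ifs <;> simp
    simp_rw [this]
    simp [Fintype.card_units, Nat.cast_sub (Fintype.card_pos (α := K))]
  rw [sum_add_distrib] at h3
  simp [h2.symm] at h
  linear_combination h3 + h

theorem gaussSum_duplication {K : Type*} [Field K] [Fintype K]
    (h2 : (2 : K) ≠ 0) {η : MulChar K ℂ} (hη : η ≠ 1) (hη2 : η ^ 2 = 1)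
    {θ : AddChar K ℂ} (hθ : θ.IsPrimitive) (χ : MulChar K ℂ) :
    χ 4 * gaussSum χ θ * gaussSum (χ * η) θ = gaussSum η θ * gaussSum (χ ^ 2) θ := by
  classical
  have := Fintype.ofFinite (MulChar K ℂ)
  have h4 : (4 : K) ≠ 0 := by
    have : (4 : K) = 2 * 2 := by norm_num
    rw [this]; exact mul_ne_zero h2 h2
  have hη4 : η 4 = 1 := by
    rw [show (4 : K) = 2 ^ 2 by norm_num]
    exact MulChar.apply_pow_eq_one hη2 h2
  have hgη := normSq_gaussSum hθ hη
  have hg1 : gaussSum 1 θ = -1 := hθ.gaussSum_one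
  have hnorm : ∀ χ : MulChar K ℂ, ‖gaussSum η θ * gaussSum (χ ^ 2) θ‖ ^ 2 =
      Fintype.card K * ‖gaussSum (χ ^ 2) θ‖ ^ 2 := by
    intro χ
    rw [norm_mul, mul_pow, hgη]
  have hE : ∀ χ ∈ ({1, η} : Finset (MulChar K ℂ)), χ ^ 2 = 1 := by
    simp [hη2]
  refine Complex.eq_of_sum_mul_star_eq (B := (Fintype.card K : ℝ) ^ 2)
    (L := fun χ : MulChar K ℂ => χ 4 * gaussSum χ θ * gaussSum (χ * η) θ)
    (R := fun χ => gaussSum η θ * gaussSum (χ ^ 2) θ) (E := {1, η}) ?_ ?_ ?_ ?_ χ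
  · intro χ
    rw [norm_mul, norm_mul, MulChar.norm_apply χ h4, one_mul, mul_pow, pow_two (Fintype.card K : ℝ)]
    gcongr <;> exact normSq_gaussSum_le _ hθ
  · intro χ
    rw [hnorm, pow_two (Fintype.card K : ℝ)]
    gcongr
    exact normSq_gaussSum_le _ hθ
  · intro χ hχ
    simp only [mem_insert, mem_singleton] at hχ
    obtain rfl | rfl := hχ
    · simp [MulChar.one_apply, h4, mul_comm]
    · rw [← pow_two, hη4]; simp
  · have h1 : ∑ χ ∈ ({1, η} : Finset (MulChar K ℂ)),
        (‖gaussSum η θ * gaussSum (χ ^ 2) θ‖ ^ 2 : ℂ) = 2 * Fintype.card K := by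
      have : ∀ χ ∈ ({1, η} : Finset (MulChar K ℂ)),
          (‖gaussSum η θ * gaussSum (χ ^ 2) θ‖ ^ 2 : ℂ) = Fintype.card K := by
        intro χ hχ
        have := hnorm χ
        rw [hE χ hχ, hg1] at this
        rw [hE χ hχ, hg1]
        exact_mod_cast this.trans (by simp)
      rw [sum_congr rfl this, sum_const, card_pair hη.symm, nsmul_eq_mul, Nat.cast_two]
    have h2' : (#({1, η} : Finset (MulChar K ℂ))ᶜ : ℂ) = Fintype.card K - 3 := by
      rw [card_compl, Nat.cast_sub (card_le_univ _), MulChar.card_eq_card_sub_one,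
        card_pair hη.symm]
      push_cast
      ring
    have hs := sum_gaussSum_duplication h2 hη hη2 θ
    have hgg := gaussSum_mul_star_self hθ hη
    rw [h1, h2']
    simp_rw [star_mul, ← mul_assoc]
    rw [← sum_mul, hs, mul_assoc _ _ (star _), hgg]
    push_cast
    ring

theorem sum_mulChar_nodal_cubic {K : Type*} [Field K] [Fintype K] [DecidableEq K]
    (h3 : (3 : K) ≠ 0) {ω : K} (hω : ω ^ 2 + ω + 1 = 0)
    {ρ : MulChar K ℂ} (hρ3 : ρ ^ 3 = 1) :
    ∑ y : Kˣ, ∑ z : Kˣ, (if 1 + 27 * (y : K) * z * (y + z - 1) = 0 then ρ y * (ρ ^ 2) z else 0) =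
      (Fintype.card K : ℂ) - 3 := by
  have hω0 : ω ≠ 0 := by rintro rfl; simp at hω
  have hω1 : ω ≠ -1 := by rintro rfl; simp at hω
  have hω2 : ω ≠ -1 - ω := by
    intro h
    apply h3
    linear_combination 4 * hω - (2 * ω + 1) * h
  rw [← Fintype.sum_prod_type'
    (f := fun y z : Kˣ => if 1 + 27 * (y : K) * z * (y + z - 1) = 0 then ρ y * (ρ ^ 2) z else 0),
    ← sum_filter]
  have hcard : (#(univ \ {0, -1, -1 - ω} : Finset K) : ℂ) = Fintype.card K - 3 := by
    rw [card_sdiff_of_subset (subset_univ _), Nat.cast_sub (card_le_card (subset_univ _)),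
      card_univ]
    congr 1
    rw [card_eq_three.mpr ⟨0, -1, -1 - ω, ?_, ?_, ?_, rfl⟩]
    · norm_num
    · simp
    · intro h; exact hω1 (by linear_combination h)
    · intro h; exact hω0 (by linear_combination h)
  have hne : ∀ m ∈ (univ \ {0, -1, -1 - ω} : Finset K), m ≠ 0 ∧ m + 1 ≠ 0 ∧ m ≠ -1 - ω := by
    intro m hm
    simp only [mem_sdiff, mem_univ, mem_insert, mem_singleton, not_or, true_and] at hm
    exact ⟨hm.1, fun h => hm.2.1 (by linear_combination h), hm.2.2⟩
  rw [← hcard, card_eq_sum_ones, Nat.cast_sum, Nat.cast_one]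
  refine (sum_bij (fun m hm => (Units.mk0 (-m ^ 2 / (3 * (m + 1)))
      (div_ne_zero (neg_ne_zero.mpr (pow_ne_zero _ (hne m hm).1))
        (mul_ne_zero h3 (hne m hm).2.1)),
    Units.mk0 (-1 / (3 * m * (m + 1)))
      (div_ne_zero (neg_ne_zero.mpr one_ne_zero)
        (mul_ne_zero (mul_ne_zero h3 (hne m hm).1) (hne m hm).2.1)))) ?_ ?_ ?_ ?_).symm
  · intro m hm
    obtain ⟨h0, h1, -⟩ := hne m hm
    simp only [mem_filter, mem_univ, true_and, Units.val_mk0]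
    field_simp
    ring
  · intro m hm n hn h
    obtain ⟨h0, h1, h2⟩ := hne m hm
    obtain ⟨k0, k1, k2⟩ := hne n hn
    simp only [Prod.mk.injEq, Units.mk0_inj] at h
    obtain ⟨e1, e2⟩ := h
    field_simp at e1 e2
    by_contra hmn
    have hmn' : m - n ≠ 0 := sub_ne_zero.mpr hmn
    have f1 : m + n + 1 = 0 := by
      apply mul_left_cancel₀ hmn'
      linear_combination e2
    have hn' : n = -1 - m := by linear_combination f1
    subst hn'
    have f2 : (2 * m + 1) * (m ^ 2 + m + 1) = 0 := by
      linear_combination e1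
    have f3 : m ^ 2 + m + 1 = 0 := by
      refine (mul_eq_zero.mp f2).resolve_left fun h => hmn' ?_
      linear_combination h
    have f4 : (m - ω) * (m - (-1 - ω)) = 0 := by linear_combination f3 - hω
    rcases mul_eq_zero.mp f4 with h | h
    · exact k2 (by linear_combination -h)
    · exact h2 (by linear_combination h)
  · rintro ⟨y, z⟩ h
    simp only [mem_filter, mem_univ, true_and] at h
    have hy := y.ne_zero
    have hz := z.ne_zero
    obtain ⟨s, hs⟩ : ∃ s : K, s = 3 * y - 1 := ⟨_, rfl⟩
    obtain ⟨t, ht⟩ : ∃ t : K, t = 3 * z - 1 := ⟨_, rfl⟩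
    have hst : s ^ 2 + s * t + t ^ 2 + s * t * (s + t) = 0 := by
      rw [hs, ht]
      linear_combination h
    suffices ∃ m : K, m ≠ 0 ∧ m ≠ -1 ∧ m ≠ -1 - ω ∧ -m ^ 2 = y * (3 * (m + 1)) ∧
        -1 = z * (3 * m * (m + 1)) by
      obtain ⟨m, h0, h1, h2, e1, e2⟩ := this
      have hm1 : m + 1 ≠ 0 := fun h => h1 (by linear_combination h)
      refine ⟨m, by simp [h0, h1, h2], Prod.ext (Units.ext ?_) (Units.ext ?_)⟩
      · exact (div_eq_iff (mul_ne_zero h3 hm1)).mpr e1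
      · exact (div_eq_iff (mul_ne_zero (mul_ne_zero h3 h0) hm1)).mpr e2
    by_cases ht0 : t = 0
    · have hs0 : s = 0 := by simpa [ht0] using hst
      refine ⟨ω, hω0, hω1, ?_, ?_, ?_⟩
      · exact hω2
      · linear_combination -(ω + 1) * hs0 + (ω + 1) * hs - hω
      · linear_combination -ω * (ω + 1) * ht0 + ω * (ω + 1) * ht - hω
    · obtain ⟨m, hm⟩ : ∃ m : K, s = m * t := ⟨s / t, (div_mul_cancel₀ s ht0).symm⟩
      have hmt : t * (m * (m + 1)) = -(m ^ 2 + m + 1) := by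
        apply mul_left_cancel₀ (pow_ne_zero 2 ht0)
        rw [hm] at hst
        linear_combination hst
      refine ⟨m, ?_, ?_, ?_, ?_, ?_⟩
      · rintro rfl; simp at hmt
      · rintro rfl; simp at hmt
      · rintro rfl; apply ht0; linear_combination -hmt + (t + 1) * hω
      · linear_combination -hmt - (m + 1) * hm + (m + 1) * hs
      · linear_combination -hmt + m * (m + 1) * ht
  · intro m hm
    obtain ⟨h0, h1, -⟩ := hne m hm
    set z : K := -1 / (3 * m * (m + 1)) with hz
    have hz0 : z ≠ 0 := div_ne_zero (neg_ne_zero.mpr one_ne_zero)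
        (mul_ne_zero (mul_ne_zero h3 h0) h1)
    have : -m ^ 2 / (3 * (m + 1)) = m ^ 3 * z := by
      rw [hz]; field_simp
    simp only [Units.val_mk0, this]
    rw [map_mul ρ, MulChar.apply_pow_eq_one hρ3 h0, one_mul, ← MulChar.mul_apply, ← pow_succ',
      hρ3, MulChar.one_apply hz0.isUnit]

theorem sum_gaussSum_triplication {K : Type*} [Field K] [Fintype K] [Fintype (MulChar K ℂ)]
    (h3 : (3 : K) ≠ 0) {ω : K} (hω : ω ^ 2 + ω + 1 = 0)
    {ρ : MulChar K ℂ} (hρ : ρ ≠ 1) (hρ3 : ρ ^ 3 = 1) {θ : AddChar K ℂ} (hθ : θ.IsPrimitive) :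
    ∑ χ : MulChar K ℂ, χ 27 * gaussSum χ θ * gaussSum (χ * ρ) θ * gaussSum (χ * ρ ^ 2) θ *
        star (gaussSum (χ ^ 3) θ) =
      Fintype.card K * (Fintype.card K - 1) * (Fintype.card K - 3) := by
  classical
  have h27 : (27 : K) ≠ 0 := by
    have : (27 : K) = 3 * 3 * 3 := by norm_num
    rw [this]; exact mul_ne_zero (mul_ne_zero h3 h3) h3
  set k : Kˣ := Units.mk0 27 h27 with hk
  have hkv : (k : K) = 27 := rfl
  have step : ∀ χ : MulChar K ℂ,
      χ 27 * gaussSum χ θ * gaussSum (χ * ρ) θ * gaussSum (χ * ρ ^ 2) θ *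
        star (gaussSum (χ ^ 3) θ) =
      ∑ w : Kˣ, ∑ y : Kˣ, ∑ z : Kˣ, ∑ x : Kˣ, χ ((k * y * z : Kˣ) * x) *
        (ρ y * (ρ ^ 2) z * θ (w * (x + y + z - 1))) := by
    intro χ
    rw [star_gaussSum_pow, mul_sum]
    refine sum_congr rfl fun w _ => ?_
    rw [gaussSum_eq_mul_sum_units χ θ w, gaussSum_eq_mul_sum_units (χ * ρ) θ w,
      gaussSum_eq_mul_sum_units (χ * ρ ^ 2) θ w]
    have hw : χ w ≠ 0 := MulChar.apply_ne_zero_iff.mpr w.isUnit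
    have hρw : ρ w * (ρ ^ 2) w = 1 := by
      rw [← MulChar.mul_apply, ← pow_succ', hρ3, MulChar.one_apply_coe]
    have : χ 27 * (χ w * ∑ x : Kˣ, χ x * θ (w * x)) *
        ((χ * ρ) w * ∑ x : Kˣ, (χ * ρ) x * θ (w * x)) *
        ((χ * ρ ^ 2) w * ∑ x : Kˣ, (χ * ρ ^ 2) x * θ (w * x)) * ((χ w)⁻¹ ^ 3 * θ (-w)) =
        (∑ x : Kˣ, (χ * ρ) x * θ (w * x)) * ((∑ x : Kˣ, (χ * ρ ^ 2) x * θ (w * x)) *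
          ∑ x : Kˣ, χ x * θ (w * x)) * (χ 27 * θ (-w)) := by
      rw [MulChar.mul_apply, MulChar.mul_apply]
      field_simp
      linear_combination (∑ x : Kˣ, χ x * θ (w * x)) * (∑ x : Kˣ, (χ * ρ) x * θ (w * x)) *
        (∑ x : Kˣ, (χ * ρ ^ 2) x * θ (w * x)) * (χ 27 * θ (-w)) * hρw
    rw [this, sum_mul, sum_mul]
    refine sum_congr rfl fun y _ => ?_
    rw [sum_mul_sum, mul_sum, sum_mul]
    refine sum_congr rfl fun z _ => ?_
    rw [mul_sum, sum_mul]
    refine sum_congr rfl fun x _ => ?_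
    rw [show (w : K) * (x + y + z - 1) = w * x + w * y + w * z + -w by ring,
      AddChar.map_add_eq_mul, AddChar.map_add_eq_mul, AddChar.map_add_eq_mul, MulChar.mul_apply,
      MulChar.mul_apply, Units.val_mul, Units.val_mul, map_mul χ, map_mul χ, map_mul χ, hkv]
    ring
  have orth : ∀ w : Kˣ, ∑ χ : MulChar K ℂ, ∑ y : Kˣ, ∑ z : Kˣ, ∑ x : Kˣ,
      χ ((k * y * z : Kˣ) * x) * (ρ y * (ρ ^ 2) z * θ (w * (x + y + z - 1))) =
      ∑ y : Kˣ, ∑ z : Kˣ, (Fintype.card K - 1) *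
        (ρ y * (ρ ^ 2) z * θ (w * (((k * y * z)⁻¹ : Kˣ) + y + z - 1))) := by
    intro w
    rw [sum_comm]
    refine sum_congr rfl fun y _ => ?_
    rw [sum_comm]
    exact sum_congr rfl fun z _ => MulChar.sum_sum_apply_mul (k * y * z)
      fun x => ρ y * (ρ ^ 2) z * θ (w * (x + y + z - 1))
  have key : ∀ y z : Kˣ, ∑ w : Kˣ, (Fintype.card K - 1) *
      (ρ y * (ρ ^ 2) z * θ (w * (((k * y * z)⁻¹ : Kˣ) + y + z - 1))) =
      (Fintype.card K - 1) * (Fintype.card K *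
        (if 1 + 27 * (y : K) * z * (y + z - 1) = 0 then ρ y * (ρ ^ 2) z else 0) -
          ρ y * (ρ ^ 2) z) := by
    intro y z
    rw [← mul_sum, ← mul_sum, hθ.sum_units_mul]
    have hiff : (((k * y * z)⁻¹ : Kˣ) + y + z - 1 : K) = 0 ↔
        1 + 27 * (y : K) * z * (y + z - 1) = 0 := by
      have hy := y.ne_zero
      have hz := z.ne_zero
      have : (((k * y * z)⁻¹ : Kˣ) + y + z - 1 : K) =
          (1 + 27 * (y : K) * z * (y + z - 1)) / (27 * y * z) := by
        rw [Units.val_inv_eq_inv_val, Units.val_mul, Units.val_mul, hkv]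
        field_simp
        ring
      rw [this, div_eq_zero_iff, or_iff_left]
      exact mul_ne_zero (mul_ne_zero h27 hy) hz
    simp only [hiff]
    split_ifs <;> ring
  have hzero : ∑ y : Kˣ, ρ y * ∑ z : Kˣ, (ρ ^ 2) z = 0 := by
    have : ∑ w : Kˣ, ρ w = 0 := by
      have := MulChar.sum_eq_zero_of_ne_one hρ
      rwa [Fintype.sum_eq_zero_add_sum_units, MulChar.map_zero, zero_add] at this
    rw [← sum_mul, this, zero_mul]
  have swap : ∀ f : Kˣ → Kˣ → Kˣ → ℂ,
      ∑ w, ∑ y, ∑ z, f w y z = ∑ y, ∑ z, ∑ w, f w y z := fun f => by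
    rw [sum_comm]
    exact sum_congr rfl fun y _ => sum_comm
  simp_rw [step]
  rw [sum_comm]
  simp_rw [orth]
  rw [swap]
  simp_rw [key, ← mul_sum, sum_sub_distrib, ← mul_sum]
  rw [sum_mulChar_nodal_cubic h3 hω hρ3, hzero]
  ring

theorem gaussSum_triplication {K : Type*} [Field K] [Fintype K]
    (h3 : (3 : K) ≠ 0) {ω : K} (hω : ω ^ 2 + ω + 1 = 0)
    {ρ : MulChar K ℂ} (hρ : ρ ≠ 1) (hρ3 : ρ ^ 3 = 1) {θ : AddChar K ℂ} (hθ : θ.IsPrimitive)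
    (χ : MulChar K ℂ) :
    χ 27 * gaussSum χ θ * gaussSum (χ * ρ) θ * gaussSum (χ * ρ ^ 2) θ =
      Fintype.card K * gaussSum (χ ^ 3) θ := by
  classical
  have := Fintype.ofFinite (MulChar K ℂ)
  have h27 : (27 : K) = 3 ^ 3 := by norm_num
  have h27' : (27 : K) ≠ 0 := h27 ▸ pow_ne_zero 3 h3
  have hρ2 : ρ ^ 2 = ρ⁻¹ := eq_inv_of_mul_eq_one_left (by rw [← pow_succ, hρ3])
  have hρ2' : ρ ^ 2 ≠ 1 := by rwa [hρ2, inv_ne_one]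
  have hρρ2 : ρ ≠ ρ ^ 2 := fun h => hρ (by
    rw [pow_two] at h
    exact mul_eq_left.mp h.symm)
  have hρ27 : ρ 27 = 1 := by
    rw [h27]
    exact MulChar.apply_pow_eq_one hρ3 h3
  have hρneg : ρ (-1) = 1 := by
    rw [show (-1 : K) = (-1) ^ 3 by norm_num]
    exact MulChar.apply_pow_eq_one hρ3 (neg_ne_zero.mpr one_ne_zero)
  have hg1 : gaussSum 1 θ = -1 := hθ.gaussSum_one
  have hgρ : gaussSum ρ θ * gaussSum (ρ ^ 2) θ = Fintype.card K := by
    rw [hρ2, gaussSum_mul_gaussSum_inv hθ hρ, hρneg, one_mul]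
  have hE : ∀ χ ∈ ({1, ρ, ρ ^ 2} : Finset (MulChar K ℂ)), χ ^ 3 = 1 := by
    simp [hρ3, pow_right_comm ρ 2 3]
  have hcard : #({1, ρ, ρ ^ 2} : Finset (MulChar K ℂ)) = 3 :=
    card_eq_three.mpr ⟨1, ρ, ρ ^ 2, hρ.symm, hρ2'.symm, hρρ2, rfl⟩
  have hnorm : ∀ χ : MulChar K ℂ, ‖Fintype.card K * gaussSum (χ ^ 3) θ‖ ^ 2 =
      (Fintype.card K : ℝ) ^ 2 * ‖gaussSum (χ ^ 3) θ‖ ^ 2 := by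
    intro χ
    rw [norm_mul, mul_pow, Complex.norm_natCast]
  refine Complex.eq_of_sum_mul_star_eq (B := (Fintype.card K : ℝ) ^ 3)
    (L := fun χ : MulChar K ℂ =>
      χ 27 * gaussSum χ θ * gaussSum (χ * ρ) θ * gaussSum (χ * ρ ^ 2) θ)
    (R := fun χ => Fintype.card K * gaussSum (χ ^ 3) θ) (E := {1, ρ, ρ ^ 2}) ?_ ?_ ?_ ?_ χ
  · intro χ
    rw [norm_mul, norm_mul, norm_mul, MulChar.norm_apply χ h27', one_mul, mul_pow, mul_pow,
      show (Fintype.card K : ℝ) ^ 3 = Fintype.card K * Fintype.card K * Fintype.card K by ring]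
    gcongr <;> exact normSq_gaussSum_le _ hθ
  · intro χ
    rw [hnorm, pow_succ (Fintype.card K : ℝ) 2]
    gcongr
    exact normSq_gaussSum_le _ hθ
  · intro χ hχ
    rw [hE χ hχ, hg1]
    simp only [mem_insert, mem_singleton] at hχ
    obtain rfl | rfl | rfl := hχ
    · rw [MulChar.one_apply h27'.isUnit, one_mul, one_mul, one_mul, mul_assoc, hgρ, hg1]
      ring
    · rw [hρ27, ← pow_two, ← pow_succ', hρ3, hg1, one_mul, hgρ]
    · rw [MulChar.pow_apply' _ two_ne_zero, hρ27, ← pow_succ, hρ3, ← pow_add,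
        show ρ ^ (2 + 2) = ρ ^ 3 * ρ from pow_succ ρ 3, hρ3, hg1, one_mul, one_pow]
      linear_combination -hgρ
  · have h1 : ∑ χ ∈ ({1, ρ, ρ ^ 2} : Finset (MulChar K ℂ)),
        (‖Fintype.card K * gaussSum (χ ^ 3) θ‖ ^ 2 : ℂ) = 3 * (Fintype.card K : ℂ) ^ 2 := by
      have : ∀ χ ∈ ({1, ρ, ρ ^ 2} : Finset (MulChar K ℂ)),
          (‖Fintype.card K * gaussSum (χ ^ 3) θ‖ ^ 2 : ℂ) = (Fintype.card K : ℂ) ^ 2 := by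
        intro χ hχ
        rw [hE χ hχ, hg1]
        simp
      rw [sum_congr rfl this, sum_const, hcard, nsmul_eq_mul, Nat.cast_ofNat]
    have h2 : (#({1, ρ, ρ ^ 2} : Finset (MulChar K ℂ))ᶜ : ℂ) = Fintype.card K - 4 := by
      rw [card_compl, Nat.cast_sub (card_le_univ _), MulChar.card_eq_card_sub_one, hcard]
      push_cast
      ring
    have hs := sum_gaussSum_triplication h3 hω hρ hρ3 hθ
    rw [h1, h2]
    simp_rw [star_mul, ← mul_assoc]
    rw [← sum_mul, hs]
    simp only [star_natCast]
    push_cast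
    ring

theorem MulChar.sum_units_apply {K : Type*} [Field K] [Fintype K] [DecidableEq K]
    (χ : MulChar K ℂ) [Decidable (χ = 1)] :
    ∑ u : Kˣ, χ u = if χ = 1 then (Fintype.card K : ℂ) - 1 else 0 := by
  split_ifs with h
  · simp [h, Fintype.card_units, Nat.cast_sub Fintype.card_pos]
  · have := MulChar.sum_eq_zero_of_ne_one h
    rwa [Fintype.sum_eq_zero_add_sum_units, MulChar.map_zero, zero_add] at this

theorem sum_units_quadratic_mul_addChar {K : Type*} [Field K] [Fintype K] [DecidableEq K]
    {η : MulChar K ℂ} (hη : η ≠ 1) (hη2 : η ^ 2 = 1) (θ : AddChar K ℂ) (u : K) :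
    ∑ t : Kˣ, η t * θ (t * u) = η u * gaussSum η θ := by
  classical
  by_cases hu : u = 0
  · simp [hu, MulChar.sum_units_apply, hη, MulChar.map_zero]
  · have := sum_units_mulChar_mul_addChar η θ (Units.mk0 u hu)
    rwa [inv_eq_of_mul_eq_one_right (by rw [← pow_two, hη2])] at this

theorem gaussSum_mul_sum_trinomial {K : Type*} [Field K] [Fintype K] [DecidableEq K]
    {η : MulChar K ℂ} (hη : η ≠ 1) (hη2 : η ^ 2 = 1) (θ : AddChar K ℂ)
    (χ : MulChar K ℂ) [Decidable (χ = 1)] :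
    gaussSum η θ * ∑ c : Kˣ, χ c * ∑ z : K, η (1 + z + c * z ^ 3) =
      gaussSum χ θ * gaussSum (χ⁻¹ ^ 3) θ * gaussSum (η * χ ^ 2) θ +
        if χ = 1 then (Fintype.card K - 1) * gaussSum η θ else 0 := by
  have h0 : ∑ c : Kˣ, χ c * gaussSum η θ =
      if χ = 1 then (Fintype.card K - 1) * gaussSum η θ else 0 := by
    rw [← sum_mul, MulChar.sum_units_apply]
    split_ifs <;> simp
  have inner : ∀ z t : Kˣ, ∑ c : Kˣ, χ c * (η t * θ (t * (1 + z + c * z ^ 3))) =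
      η t * θ t * χ⁻¹ t * gaussSum χ θ * ((χ⁻¹ ^ 3) z * θ (z * t)) := by
    intro z t
    have h := sum_units_mulChar_mul_addChar χ θ (t * z ^ 3)
    calc _ = ∑ c : Kˣ, η t * θ t * θ (z * t) * (χ c * θ (c * (t * z ^ 3 : Kˣ))) := by
          refine sum_congr rfl fun c _ => ?_
          rw [show (t : K) * (1 + z + c * z ^ 3) = t + z * t + c * (t * z ^ 3) by ring,
            AddChar.map_add_eq_mul, AddChar.map_add_eq_mul]
          push_cast
          ring
      _ = _ := by
          rw [← mul_sum, h, MulChar.pow_apply_coe, Units.val_mul, map_mul χ⁻¹,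
            Units.val_pow_eq_pow_val, map_pow χ⁻¹]
          ring
  have middle : ∀ t : Kˣ, ∑ z : Kˣ, η t * θ t * χ⁻¹ t * gaussSum χ θ *
      ((χ⁻¹ ^ 3) z * θ (z * t)) =
      gaussSum χ θ * gaussSum (χ⁻¹ ^ 3) θ * ((η * χ ^ 2) t * θ t) := by
    intro t
    rw [← mul_sum, sum_units_mulChar_mul_addChar]
    have : χ⁻¹ t * (χ⁻¹ ^ 3)⁻¹ t = (χ ^ 2) t := by
      rw [← MulChar.mul_apply]
      congr 1
      group
    rw [MulChar.mul_apply, ← this]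
    ring
  calc _ = ∑ c : Kˣ, χ c * ∑ z : K, η (1 + z + c * z ^ 3) * gaussSum η θ := by
        rw [mul_sum]
        refine sum_congr rfl fun c _ => ?_
        rw [← sum_mul]
        ring
    _ = ∑ c : Kˣ, (χ c * gaussSum η θ +
          ∑ z : Kˣ, ∑ t : Kˣ, χ c * (η t * θ (t * (1 + z + c * z ^ 3)))) := by
        refine sum_congr rfl fun c _ => ?_
        rw [Fintype.sum_eq_zero_add_sum_units, mul_add, mul_sum]
        simp_rw [← sum_units_quadratic_mul_addChar hη hη2, mul_sum]
        simp [gaussSum_eq_sum_units, mul_sum]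
    _ = gaussSum χ θ * gaussSum (χ⁻¹ ^ 3) θ * gaussSum (η * χ ^ 2) θ +
          ∑ c : Kˣ, χ c * gaussSum η θ := by
        rw [sum_add_distrib, add_comm, sum_comm]
        congr 1
        simp_rw [sum_comm (f := fun (c t : Kˣ) => χ c * _), inner]
        rw [sum_comm]
        simp_rw [middle]
        rw [← mul_sum, ← gaussSum_eq_sum_units]
    _ = _ := by rw [h0]

theorem gaussSum_mul_sum_trinomial_eq {K : Type*} [Field K] [Fintype K] [DecidableEq K]
    (h3 : (3 : K) ≠ 0) {ω : K} (hω : ω ^ 2 + ω + 1 = 0)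
    {η ρ : MulChar K ℂ} (hη : η ≠ 1) (hη2 : η ^ 2 = 1) (hρ : ρ ≠ 1) (hρ3 : ρ ^ 3 = 1)
    {θ : AddChar K ℂ} (hθ : θ.IsPrimitive) (χ : MulChar K ℂ) :
    gaussSum η θ * ∑ c : Kˣ, χ c * ∑ z : K, η (1 + z + c * z ^ 3) =
      χ⁻¹ (-27) * gaussSum (χ⁻¹ * ρ) θ * gaussSum (χ⁻¹ * ρ ^ 2) θ * gaussSum (η * χ ^ 2) θ := by
  classical
  have hq : (Fintype.card K : ℂ) ≠ 0 := Nat.cast_ne_zero.mpr Fintype.card_ne_zero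
  have h27 : (27 : K) ≠ 0 := by
    rw [show (27 : K) = 3 ^ 3 by norm_num]
    exact pow_ne_zero 3 h3
  have htri := gaussSum_triplication h3 hω hρ hρ3 hθ χ⁻¹
  have hneg : χ⁻¹ (-27) = χ (-1) * χ⁻¹ 27 := by
    rw [show (-27 : K) = (-1) * 27 by norm_num, map_mul, MulChar.inv_apply' χ (-1)]
    norm_num
  rw [gaussSum_mul_sum_trinomial hη hη2]
  apply mul_left_cancel₀ hq
  by_cases h : χ = 1
  · subst h
    rw [if_pos rfl, inv_one, MulChar.one_apply h27.isUnit.neg]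
    simp only [inv_one, one_pow, one_mul, mul_one, hθ.gaussSum_one,
      MulChar.one_apply h27.isUnit] at htri ⊢
    linear_combination (Fintype.card K : ℂ) * gaussSum η θ * htri
  · have hχ := gaussSum_mul_gaussSum_inv hθ h
    rw [if_neg h, hneg]
    linear_combination (-gaussSum χ θ * gaussSum (η * χ ^ 2) θ) * htri +
      χ⁻¹ 27 * gaussSum (χ⁻¹ * ρ) θ * gaussSum (χ⁻¹ * ρ ^ 2) θ * gaussSum (η * χ ^ 2) θ * hχ

theorem MulChar.apply_neg_one_mul_self {K : Type*} [Field K] (χ : MulChar K ℂ) :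
    χ (-1) * χ (-1) = 1 := by
  rw [← map_mul, neg_one_mul, neg_neg, map_one]

theorem MulChar.inv_apply_neg_one {K : Type*} [Field K] (χ : MulChar K ℂ) :
    χ⁻¹ (-1) = χ (-1) := by
  rw [MulChar.inv_apply', inv_neg_one]

theorem card_mul_jacobiSum {K : Type*} [Field K] [Fintype K] {θ : AddChar K ℂ}
    (hθ : θ.IsPrimitive) (χ : MulChar K ℂ) {ψ : MulChar K ℂ} (hψ : ψ ≠ 1) :
    Fintype.card K * jacobiSum χ ψ =
      (χ * ψ) (-1) * gaussSum χ θ * gaussSum ψ θ * gaussSum (χ * ψ)⁻¹ θ := by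
  by_cases h : χ * ψ = 1
  · obtain rfl : ψ = χ⁻¹ := eq_inv_of_mul_eq_one_right h
    have hχ : χ ≠ 1 := by simpa using hψ
    rw [jacobiSum_nontrivial_inv hχ, mul_inv_cancel, inv_one, hθ.gaussSum_one,
      MulChar.one_apply isUnit_one.neg]
    linear_combination gaussSum_mul_gaussSum_inv hθ hχ
  · have h1 := jacobiSum_mul_nontrivial h θ
    have h2 := gaussSum_mul_gaussSum_inv hθ h
    have h3 := MulChar.apply_neg_one_mul_self (χ * ψ)
    linear_combination (χ * ψ) (-1) * gaussSum (χ * ψ)⁻¹ θ * h1 -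
      (χ * ψ) (-1) * jacobiSum χ ψ * h2 - Fintype.card K * jacobiSum χ ψ * h3

theorem jacobiSum_eq_sum_units {K : Type*} [Field K] [Fintype K] [DecidableEq K]
    (χ ψ : MulChar K ℂ) : jacobiSum χ ψ = ∑ u : Kˣ, χ u * ψ (1 - u) := by
  rw [jacobiSum, Fintype.sum_eq_zero_add_sum_units, MulChar.map_zero, zero_mul, zero_add]

theorem sum_mul_sum_euler {K : Type*} [Field K] [Fintype K] [DecidableEq K]
    (ψ α β γ : MulChar K ℂ) :
    ∑ w : Kˣ, ψ w * ∑ u : Kˣ, α u * β (1 - u) * γ (1 + w * u) =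
      ψ (-1) * jacobiSum ψ γ * jacobiSum (α * ψ⁻¹) β := by
  have h1 : ∀ u : Kˣ, ∑ w : Kˣ, ψ w * (α u * β (1 - u) * γ (1 + w * u)) =
      ψ (-1) * jacobiSum ψ γ * ((α * ψ⁻¹) u * β (1 - u)) := by
    intro u
    calc _ = ∑ w : Kˣ, ψ (-1) * (ψ w * γ (1 - w)) * ((α * ψ⁻¹) u * β (1 - u)) := by
          refine Fintype.sum_equiv (Equiv.mulRight (-u)) _ _ fun w => ?_
          have : ψ u * ψ⁻¹ u = 1 := by
            rw [← MulChar.mul_apply, mul_inv_cancel, MulChar.one_apply_coe]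
          simp only [Equiv.coe_mulRight, Units.val_mul, Units.val_neg, MulChar.mul_apply]
          rw [show (w : K) * -u = (-1) * (w * u) by ring, map_mul ψ, map_mul ψ,
            show 1 - (-1 : K) * (w * u) = 1 + w * u by ring]
          linear_combination -(ψ (-1) * ψ (-1) * ψ w * α u * β (1 - u) * γ (1 + w * u)) * this -
            ψ w * α u * β (1 - u) * γ (1 + w * u) * MulChar.apply_neg_one_mul_self ψ
      _ = _ := by rw [← sum_mul, ← mul_sum, jacobiSum_eq_sum_units]
  simp_rw [mul_sum]
  rw [sum_comm]
  simp_rw [h1]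
  rw [← mul_sum, ← jacobiSum_eq_sum_units]

theorem card_mul_sum_trinomial {K : Type*} [Field K] [Fintype K] [DecidableEq K]
    (h2 : (2 : K) ≠ 0) (h3 : (3 : K) ≠ 0) {ω : K} (hω : ω ^ 2 + ω + 1 = 0)
    {A : MulChar K ℂ} (hA : A ^ 12 = 1) (hA4 : A ^ 4 ≠ 1) (hA6 : A ^ 6 ≠ 1)
    {θ : AddChar K ℂ} (hθ : θ.IsPrimitive) (ψ : MulChar K ℂ) :
    Fintype.card K * ∑ c : Kˣ, (ψ * A ^ 3) c * ∑ z : K, (A ^ 6) (1 + z + c * z ^ 3) =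
      (ψ * A ^ 3)⁻¹ (-27) * ψ 4 * (gaussSum ψ θ * gaussSum (ψ⁻¹ * A) θ *
        gaussSum (ψ * A ^ 6) θ * gaussSum (ψ⁻¹ * A ^ 5) θ) := by
  have h62 : (A ^ 6) ^ 2 = 1 := by rw [← pow_mul, hA]
  have h := gaussSum_mul_sum_trinomial_eq h3 hω hA6 h62 hA4 (by rw [← pow_mul, hA]) hθ (ψ * A ^ 3)
  have hd := gaussSum_duplication h2 hA6 h62 hθ ψ
  have hg := gaussSum_mul_gaussSum_inv hθ hA6
  rw [inv_eq_of_mul_eq_one_right (by rw [← pow_two, h62] : A ^ 6 * A ^ 6 = 1),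
    MulChar.pow_apply' _ (by norm_num), ← map_pow A, show (-1 : K) ^ 6 = 1 by norm_num,
    map_one, one_mul] at hg
  have e1 : (ψ * A ^ 3)⁻¹ * A ^ 4 = ψ⁻¹ * A := by
    rw [mul_inv, mul_assoc]; congr 1; group
  have e2 : (ψ * A ^ 3)⁻¹ * (A ^ 4) ^ 2 = ψ⁻¹ * A ^ 5 := by
    rw [mul_inv, mul_assoc]; congr 1; group
  have e3 : A ^ 6 * (ψ * A ^ 3) ^ 2 = ψ ^ 2 := by
    calc _ = ψ ^ 2 * A ^ 12 := by
          rw [mul_pow, ← pow_mul, mul_left_comm, ← pow_add]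
      _ = _ := by rw [hA, mul_one]
  rw [e1, e2, e3] at h
  rw [← hg]
  linear_combination gaussSum (A ^ 6) θ * h - (ψ * A ^ 3)⁻¹ (-27) * gaussSum (ψ⁻¹ * A) θ *
    gaussSum (ψ⁻¹ * A ^ 5) θ * hd

theorem card_mul_sum_euler {K : Type*} [Field K] [Fintype K] [DecidableEq K]
    {A : MulChar K ℂ} (hA : A ^ 12 = 1) (hA1 : A ≠ 1)
    {θ : AddChar K ℂ} (hθ : θ.IsPrimitive) (ψ : MulChar K ℂ) :
    Fintype.card K *
        ∑ w : Kˣ, ψ w * ∑ u : Kˣ, (A ^ 5) u * A (1 - u) * A⁻¹ (1 + w * u) =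
      ψ (-1) * (gaussSum ψ θ * gaussSum (ψ⁻¹ * A) θ *
        gaussSum (ψ * A ^ 6) θ * gaussSum (ψ⁻¹ * A ^ 5) θ) := by
  have hq : (Fintype.card K : ℂ) ≠ 0 := Nat.cast_ne_zero.mpr Fintype.card_ne_zero
  have h1 := card_mul_jacobiSum hθ ψ (inv_ne_one.mpr hA1)
  have h2 := card_mul_jacobiSum hθ (A ^ 5 * ψ⁻¹) hA1
  have hg := gaussSum_mul_gaussSum_inv hθ hA1
  have e1 : (ψ * A⁻¹)⁻¹ = ψ⁻¹ * A := by rw [mul_inv, inv_inv]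
  have e2 : A ^ 5 * ψ⁻¹ * A = A ^ 6 * ψ⁻¹ := by rw [mul_right_comm, ← pow_succ]
  have e3 : (A ^ 6 * ψ⁻¹)⁻¹ = ψ * A ^ 6 := by
    rw [mul_inv, inv_inv, mul_comm]
    congr 1
    exact inv_eq_of_mul_eq_one_right (by rw [← pow_add, hA])
  have s1 : (ψ * A⁻¹) (-1) = ψ (-1) * A (-1) := by
    rw [MulChar.mul_apply, MulChar.inv_apply_neg_one]
  have s2 : (A ^ 6 * ψ⁻¹) (-1) = ψ (-1) := by
    rw [MulChar.mul_apply, MulChar.inv_apply_neg_one, MulChar.pow_apply' _ (by norm_num),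
      ← map_pow A, show (-1 : K) ^ 6 = 1 by norm_num, map_one, one_mul]
  rw [e1, s1] at h1
  rw [e2, e3, s2, mul_comm (A ^ 5)] at h2
  rw [sum_mul_sum_euler, mul_comm (A ^ 5)]
  apply mul_left_cancel₀ hq
  have sψ := MulChar.apply_neg_one_mul_self ψ
  have sA := MulChar.apply_neg_one_mul_self A
  calc _ = ψ (-1) * (Fintype.card K * jacobiSum ψ A⁻¹) *
        (Fintype.card K * jacobiSum (ψ⁻¹ * A ^ 5) A) := by ring
    _ = (ψ (-1) * ψ (-1)) * ψ (-1) * A (-1) * (gaussSum A θ * gaussSum A⁻¹ θ) *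
          (gaussSum ψ θ * gaussSum (ψ⁻¹ * A) θ *
        gaussSum (ψ * A ^ 6) θ * gaussSum (ψ⁻¹ * A ^ 5) θ) := by rw [h1, h2]; ring
    _ = (A (-1) * A (-1)) * (Fintype.card K * (ψ (-1) * (gaussSum ψ θ * gaussSum (ψ⁻¹ * A) θ *
        gaussSum (ψ * A ^ 6) θ * gaussSum (ψ⁻¹ * A ^ 5) θ))) := by rw [sψ, hg]; ring
    _ = _ := by rw [sA, one_mul]

theorem sum_trinomial_eq_sum_euler {K : Type*} [Field K] [Fintype K] [DecidableEq K]
    (h2 : (2 : K) ≠ 0) (h3 : (3 : K) ≠ 0) {ω : K} (hω : ω ^ 2 + ω + 1 = 0)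
    {A : MulChar K ℂ} (hA : A ^ 12 = 1) (hA4 : A ^ 4 ≠ 1) (hA6 : A ^ 6 ≠ 1)
    {θ : AddChar K ℂ} (hθ : θ.IsPrimitive) (c : Kˣ) :
    (A ^ 3) c * ∑ z : K, (A ^ 6) (1 + z + c * z ^ 3) =
      A (-27) * ∑ u : Kˣ, (A ^ 5) u * A (1 - u) * A⁻¹ (1 + (27 / 4 * c : K) * u) := by
  have hq : (Fintype.card K : ℂ) ≠ 0 := Nat.cast_ne_zero.mpr Fintype.card_ne_zero
  have hA1 : A ≠ 1 := by rintro rfl; simp at hA4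
  have h4 : (4 : K) ≠ 0 := by
    rw [show (4 : K) = 2 ^ 2 by norm_num]
    exact pow_ne_zero 2 h2
  have h27 : (27 : K) ≠ 0 := by
    rw [show (27 : K) = 3 ^ 3 by norm_num]
    exact pow_ne_zero 3 h3
  set k : Kˣ := Units.mk0 (27 / 4) (div_ne_zero h27 h4) with hk
  have hkv : (k : K) = 27 / 4 := rfl
  have hA27 : (A ^ 3)⁻¹ (-27) = A (-27) := by
    have h9 : (9 : K) ≠ 0 := by
      rw [show (9 : K) = 3 ^ 2 by norm_num]
      exact pow_ne_zero 2 h3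
    have h8 : A (-27) ^ 8 = 1 := by
      rw [← map_pow A, show (-27 : K) ^ 8 = 9 ^ 12 by norm_num]
      exact MulChar.apply_pow_eq_one hA h9
    rw [inv_eq_of_mul_eq_one_right (by rw [← pow_add, hA] : A ^ 3 * A ^ 9 = 1),
      MulChar.pow_apply' _ (by norm_num), pow_succ, h8, one_mul]
  refine MulChar.eq_of_sum_units_eq
    (f := fun c : Kˣ => (A ^ 3) c * ∑ z : K, (A ^ 6) (1 + z + c * z ^ 3))
    (g := fun c : Kˣ => A (-27) *
      ∑ u : Kˣ, (A ^ 5) u * A (1 - u) * A⁻¹ (1 + (27 / 4 * c : K) * u)) (fun ψ => ?_) c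
  apply mul_left_cancel₀ hq
  have hl := card_mul_sum_trinomial h2 h3 hω hA hA4 hA6 hθ ψ
  have hr := card_mul_sum_euler hA hA1 hθ ψ
  have hshift : ∑ w : Kˣ, ψ w * ∑ u : Kˣ, (A ^ 5) u * A (1 - u) * A⁻¹ (1 + w * u) =
      ψ k * ∑ c : Kˣ, ψ c * ∑ u : Kˣ, (A ^ 5) u * A (1 - u) * A⁻¹ (1 + (27 / 4 * c : K) * u) := by
    rw [mul_sum]
    refine (Fintype.sum_equiv (Equiv.mulLeft k) _ _ fun w => ?_).symm
    simp only [Equiv.coe_mulLeft, Units.val_mul, map_mul ψ, hkv, mul_assoc]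
  have hs : (ψ * A ^ 3)⁻¹ (-27) * ψ 4 * ψ k = ψ (-1) * A (-27) := by
    have h5 : ψ 4 * ψ k = ψ 27 := by
      rw [← map_mul, hkv, mul_div_cancel₀ _ h4]
    have h6 : ψ (-27) = ψ (-1) * ψ 27 := by rw [← map_mul]; norm_num
    have h7 : ψ⁻¹ (-27) * ψ (-27) = 1 := by
      rw [← MulChar.mul_apply, inv_mul_cancel, MulChar.one_apply h27.isUnit.neg]
    rw [mul_inv, MulChar.mul_apply, hA27]
    linear_combination ψ⁻¹ (-27) * A (-27) * h5 + ψ (-1) * A (-27) * h7 -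
      ψ (-1) * ψ⁻¹ (-27) * A (-27) * h6 - ψ⁻¹ (-27) * A (-27) * ψ 27 *
        MulChar.apply_neg_one_mul_self ψ
  have hψk : ψ k ≠ 0 := MulChar.apply_ne_zero_iff.mpr k.isUnit
  apply mul_left_cancel₀ hψk
  rw [hshift] at hr
  simp_rw [MulChar.mul_apply, mul_assoc (ψ _) _ (∑ z : K, _)] at hl
  calc _ = ψ k * (Fintype.card K * ∑ c : Kˣ, ψ c * ((A ^ 3) c *
        ∑ z : K, (A ^ 6) (1 + z + c * z ^ 3))) := rfl
    _ = A (-27) * (Fintype.card K * (ψ k * ∑ c : Kˣ, ψ c *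
        ∑ u : Kˣ, (A ^ 5) u * A (1 - u) * A⁻¹ (1 + (27 / 4 * c : K) * u))) := by
      rw [hr, hl]
      linear_combination (gaussSum ψ θ * gaussSum (ψ⁻¹ * A) θ *
        gaussSum (ψ * A ^ 6) θ * gaussSum (ψ⁻¹ * A ^ 5) θ) * hs
    _ = _ := by
      simp only [mul_left_comm _ (A (-27)), ← mul_sum]
      ring

theorem MulChar.natCard_eq_card_sub_one (K : Type*) [Field K] [Fintype K] :
    Nat.card (MulChar K ℂ) = Fintype.card K - 1 := by
  rw [MulChar.card_eq_card_units_of_hasEnoughRootsOfUnity, Nat.card_units,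
    Nat.card_eq_fintype_card]

theorem orderOf_of_forall_eq_pow {K : Type*} [Field K] [Fintype K] {T : MulChar K ℂ}
    (hT : ∀ χ : MulChar K ℂ, ∃ n : ℕ, χ = T ^ n) : orderOf T = Fintype.card K - 1 := by
  rw [← MulChar.natCard_eq_card_sub_one]
  exact orderOf_eq_card_of_forall_mem_zpowers fun χ =>
    let ⟨n, hn⟩ := hT χ
    ⟨n, by simp [hn]⟩

theorem sum_range_pow_eq_sum {K : Type*} [Field K] [Fintype K] [Fintype (MulChar K ℂ)]
    {T : MulChar K ℂ} (hT : ∀ χ : MulChar K ℂ, ∃ n : ℕ, χ = T ^ n) (f : MulChar K ℂ → ℂ) :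
    ∑ m ∈ range (Fintype.card K - 1), f (T ^ m) = ∑ χ, f χ := by
  rw [← orderOf_of_forall_eq_pow hT]
  refine sum_bij (fun m _ => T ^ m) (fun _ _ => mem_univ _) ?_ ?_ fun _ _ => rfl
  · intro m hm n hn h
    exact pow_injOn_Iio_orderOf (by simpa using hm) (by simpa using hn) h
  · intro χ _
    obtain ⟨n, rfl⟩ := hT χ
    exact ⟨n % orderOf T, mem_range.mpr (Nat.mod_lt _ (orderOf_pos T)), pow_mod_orderOf T n⟩

theorem MulChar.sum_apply_mul_inv_apply {K : Type*} [Field K] [Fintype K] [DecidableEq K]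
    [Fintype (MulChar K ℂ)] (a b : K) :
    ∑ χ : MulChar K ℂ, χ a * χ⁻¹ b = if a = b ∧ a ≠ 0 then (Fintype.card K : ℂ) - 1 else 0 := by
  by_cases hb : b = 0
  · rw [if_neg (fun h => h.2 (h.1.trans hb)), hb]
    simp
  by_cases ha : a = 0
  · rw [if_neg (fun h => h.2 ha), ha]
    simp
  have h := MulChar.sum_apply_units (Units.mk0 (a / b) (div_ne_zero ha hb))
  simp only [Units.val_mk0, ← Units.val_eq_one, div_eq_one_iff_eq hb] at h
  simp only [ne_eq, ha, not_false_eq_true, and_true]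
  rw [← h]
  exact sum_congr rfl fun χ _ => by rw [MulChar.inv_apply', ← map_mul, div_eq_mul_inv]

theorem sum_sum_euler {K : Type*} [Field K] [Fintype K] [Fintype (MulChar K ℂ)]
    (A : MulChar K ℂ) {x v : K} (hx : x ≠ 0) (hv : v ≠ 0) (hv1 : 1 - v ≠ 0) :
    ∑ χ : MulChar K ℂ, ∑ u : K, A u * (χ (x * u * v) * χ⁻¹ ((1 - u) * (1 - v))) =
      (Fintype.card K - 1) * (A (1 - v) * A⁻¹ (1 - v + x * v)) := by
  classical
  rw [sum_comm]
  simp_rw [← mul_sum, MulChar.sum_apply_mul_inv_apply]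
  by_cases hD : 1 - v + x * v = 0
  · rw [hD, MulChar.map_zero, mul_zero, mul_zero]
    refine sum_eq_zero fun u _ => ?_
    rw [if_neg, mul_zero]
    rintro ⟨h, -⟩
    exact hv1 (by linear_combination u * hD - h)
  · rw [sum_eq_single ((1 - v) / (1 - v + x * v)), if_pos, MulChar.inv_apply', ← map_mul,
      ← div_eq_mul_inv, mul_comm]
    · refine ⟨?_, mul_ne_zero (mul_ne_zero hx (div_ne_zero hv1 hD)) hv⟩
      field_simp
      ring
    · intro u _ hu
      rw [if_neg, mul_zero]
      rintro ⟨h, -⟩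
      exact hu ((eq_div_iff hD).mpr (by linear_combination h))
    · exact fun h => absurd (mem_univ _) h

theorem card_mul_hypF21 {K : Type} [Field K] [Fintype K] {T : MulChar K ℂ}
    (hT : ∀ χ : MulChar K ℂ, ∃ n : ℕ, χ = T ^ n) {A : MulChar K ℂ} (hA : A ^ 12 = 1)
    {x : K} (hx : x ≠ 0) :
    Fintype.card K * hypF21 K T A A (A ^ 8) x =
      ∑ v : K, A v * (A ^ 5) (1 - v) * A⁻¹ (1 - v + x * v) := by
  classical
  have := Fintype.ofFinite (MulChar K ℂ)
  have hq : (Fintype.card K : ℂ) ≠ 0 := Nat.cast_ne_zero.mpr Fintype.card_ne_zero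
  have hq1 : (Fintype.card K : ℂ) - 1 ≠ 0 := by
    rw [sub_ne_zero]
    exact_mod_cast (Fintype.one_lt_card (α := K)).ne'
  have hA8 : (A ^ 8)⁻¹ = A ^ 4 := inv_eq_of_mul_eq_one_right (by rw [← pow_add, hA])
  have hA8' : (A ^ 8) (-1) = 1 := by
    rw [MulChar.pow_apply' _ (by norm_num), ← map_pow A, show (-1 : K) ^ 8 = 1 by norm_num,
      map_one]
  have term : ∀ χ : MulChar K ℂ,
      (Fintype.card K : ℂ) ^ 2 * (binomC K (A * χ) χ * binomC K (A * χ) (A ^ 8 * χ) * χ x) =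
      ∑ v : K, A v * (A ^ 4) (1 - v) *
        ∑ u : K, A u * (χ (x * u * v) * χ⁻¹ ((1 - u) * (1 - v))) := by
    intro χ
    calc _ = jacobiSum (A * χ) (A ^ 8 * χ)⁻¹ * jacobiSum (A * χ) χ⁻¹ * χ x := by
          rw [binomC, binomC, MulChar.mul_apply, hA8']
          field_simp
          linear_combination jacobiSum (A * χ) (A ^ 8 * χ)⁻¹ * jacobiSum (A * χ) χ⁻¹ * χ x *
            MulChar.apply_neg_one_mul_self χ
      _ = _ := by
          rw [jacobiSum, jacobiSum, sum_mul, sum_mul]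
          refine sum_congr rfl fun v _ => ?_
          rw [mul_sum, mul_sum, sum_mul]
          refine sum_congr rfl fun u _ => ?_
          rw [mul_inv, hA8, MulChar.mul_apply, MulChar.mul_apply, MulChar.mul_apply, map_mul χ,
            map_mul χ, map_mul χ⁻¹]
          ring
  have hsum : (Fintype.card K : ℂ) ^ 2 * ∑ χ : MulChar K ℂ,
      binomC K (A * χ) χ * binomC K (A * χ) (A ^ 8 * χ) * χ x =
      (Fintype.card K - 1) * ∑ v : K, A v * (A ^ 5) (1 - v) * A⁻¹ (1 - v + x * v) := by
    rw [mul_sum, mul_sum]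
    simp_rw [term]
    rw [sum_comm]
    refine sum_congr rfl fun v _ => ?_
    rw [← mul_sum]
    by_cases hv : v = 0
    · simp [hv, MulChar.map_zero]
    by_cases hv1 : 1 - v = 0
    · simp [hv1, MulChar.map_zero]
    rw [sum_sum_euler A hx hv hv1, pow_succ A 4, MulChar.mul_apply]
    ring
  apply mul_left_cancel₀ hq1
  rw [← hsum, hypF21,
    sum_range_pow_eq_sum hT fun χ => binomC K (A * χ) χ * binomC K (A * χ) (A ^ 8 * χ) * χ x]
  field_simp

theorem card_mul_apply_mul_hypF21 {K : Type} [Field K] [Fintype K] [DecidableEq K]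
    {T : MulChar K ℂ}
    (hT : ∀ χ : MulChar K ℂ, ∃ n : ℕ, χ = T ^ n) {A : MulChar K ℂ} (hA : A ^ 12 = 1)
    {x w : K} (hx : x ≠ 0) (hw : x * (1 + w) = 1) :
    Fintype.card K * (A x * hypF21 K T A A (A ^ 8) x) =
      ∑ u : Kˣ, (A ^ 5) u * A (1 - u) * A⁻¹ (1 + w * u) := by
  rw [mul_left_comm, card_mul_hypF21 hT hA hx, ← Equiv.sum_comp (Equiv.subLeft 1),
    Fintype.sum_eq_zero_add_sum_units]
  have h : A x * A⁻¹ x = 1 := by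
    rw [← MulChar.mul_apply, mul_inv_cancel, MulChar.one_apply hx.isUnit]
  simp only [Equiv.subLeft_apply, sub_sub_cancel, sub_zero]
  rw [sub_self, MulChar.map_zero, mul_zero, zero_mul, zero_add, mul_sum]
  refine sum_congr rfl fun u _ => ?_
  rw [show (u : K) + x * (1 - u) = x * (1 + w * u) by linear_combination -(u : K) * hw, map_mul A⁻¹]
  linear_combination (A ^ 5) u * A (1 - u) * A⁻¹ (1 + w * u) * h

theorem sum_cubic_eq_sum_trinomial {K : Type*} [Field K] [Fintype K] (η : MulChar K ℂ) {a b : K}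
    (ha : a ≠ 0) (hb : b ≠ 0) :
    ∑ x : K, η (x ^ 3 + a * x + b) = η b * ∑ z : K, η (1 + z + b ^ 2 / a ^ 3 * z ^ 3) := by
  rw [mul_sum, ← Equiv.sum_comp (Equiv.mulLeft₀ (b / a) (div_ne_zero hb ha))]
  refine sum_congr rfl fun z _ => ?_
  rw [← map_mul, Equiv.mulLeft₀_apply]
  congr 1
  field_simp
  ring

theorem sum_cubic_eq_card_mul_hypF21 {K : Type} [Field K] [Fintype K]
    (h2 : (2 : K) ≠ 0) (h3 : (3 : K) ≠ 0) {ω : K} (hω : ω ^ 2 + ω + 1 = 0)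
    {T : MulChar K ℂ} (hT : ∀ χ : MulChar K ℂ, ∃ n : ℕ, χ = T ^ n)
    {A : MulChar K ℂ} (hA : A ^ 12 = 1) (hA4 : A ^ 4 ≠ 1) (hA6 : A ^ 6 ≠ 1)
    {θ : AddChar K ℂ} (hθ : θ.IsPrimitive) {a b : K} (ha : a ≠ 0) (hb : b ≠ 0)
    (hΔ : 4 * a ^ 3 + 27 * b ^ 2 ≠ 0) :
    ∑ x : K, (A ^ 6) (x ^ 3 + a * x + b) =
      Fintype.card K * (A (1728 / (-16 * (4 * a ^ 3 + 27 * b ^ 2))) *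
        hypF21 K T A A (A ^ 8) (4 * a ^ 3 / (4 * a ^ 3 + 27 * b ^ 2))) := by
  classical
  have h4 : (4 : K) ≠ 0 := by
    rw [show (4 : K) = 2 ^ 2 by norm_num]
    exact pow_ne_zero 2 h2
  have h16 : (16 : K) ≠ 0 := by
    rw [show (16 : K) = 2 ^ 4 by norm_num]
    exact pow_ne_zero 4 h2
  set x : K := 4 * a ^ 3 / (4 * a ^ 3 + 27 * b ^ 2) with hx
  have hx0 : x ≠ 0 := div_ne_zero (mul_ne_zero h4 (pow_ne_zero 3 ha)) hΔ
  have hw : x * (1 + 27 / 4 * (b ^ 2 / a ^ 3)) = 1 := by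
    rw [hx]; field_simp
  have hmain := sum_trinomial_eq_sum_euler h2 h3 hω hA hA4 hA6 hθ
    (Units.mk0 (b ^ 2 / a ^ 3) (div_ne_zero (pow_ne_zero 2 hb) (pow_ne_zero 3 ha)))
  rw [Units.val_mk0, ← card_mul_apply_mul_hypF21 hT hA hx0 hw] at hmain
  have hηb : (A ^ 6) b = A⁻¹ (a ^ 3) * (A ^ 3) (b ^ 2 / a ^ 3) := by
    have : A (a ^ 12) = 1 := MulChar.apply_pow_eq_one hA ha
    rw [MulChar.inv_apply', MulChar.pow_apply' _ (by norm_num), MulChar.pow_apply' _ (by norm_num),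
      ← map_pow, ← map_pow, ← map_mul, ← mul_one (A (_ * _)), ← this, ← map_mul]
    congr 1
    field_simp
  have hdisc : A⁻¹ (a ^ 3) * A (-27) * A x = A (1728 / (-16 * (4 * a ^ 3 + 27 * b ^ 2))) := by
    rw [MulChar.inv_apply', ← map_mul, ← map_mul, hx]
    congr 1
    field_simp
    ring
  rw [sum_cubic_eq_sum_trinomial _ ha hb, hηb, mul_assoc, hmain, ← hdisc]
  ring

theorem MulChar.eq_quadraticChar {K : Type*} [Field K] [Fintype K] [DecidableEq K]
    {η : MulChar K ℂ} (hη : η ≠ 1) (hη2 : η ^ 2 = 1) (x : K) :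
    η x = (quadraticChar K x : ℂ) := by
  have hsq : ∀ y : K, y ≠ 0 → IsSquare y → η y = 1 := by
    rintro _ h0 ⟨z, rfl⟩
    rw [← pow_two]
    exact MulChar.apply_pow_eq_one hη2 (by simpa using h0)
  obtain ⟨d, hd⟩ := MulChar.ne_one_iff.mp hη
  have hd' : ¬ IsSquare (d : K) := fun h => hd (hsq d d.ne_zero h)
  have hηd : η d = -1 := by
    have : (η d) ^ 2 = 1 := by
      rw [← map_pow]
      exact MulChar.apply_pow_eq_one hη2 d.ne_zero
    rw [pow_two] at this
    exact (mul_self_eq_one_iff.mp this).resolve_left hd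
  by_cases hx : x = 0
  · simp [hx]
  by_cases h : IsSquare x
  · rw [hsq x hx h, (quadraticChar_one_iff_isSquare hx).mpr h, Int.cast_one]
  · rw [quadraticChar_neg_one_iff_not_isSquare.mpr h]
    have hxd : IsSquare (x * d) := by
      rw [← quadraticChar_one_iff_isSquare (mul_ne_zero hx d.ne_zero), map_mul,
        quadraticChar_neg_one_iff_not_isSquare.mpr h,
        quadraticChar_neg_one_iff_not_isSquare.mpr hd']
      norm_num
    have := hsq _ (mul_ne_zero hx d.ne_zero) hxd
    rw [map_mul, hηd] at this
    push_cast
    linear_combination -this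

theorem exists_sq_add_self_add_one_eq_zero {K : Type*} [Field K] [Fintype K]
    (h : 3 ∣ Fintype.card K - 1) : ∃ ω : K, ω ^ 2 + ω + 1 = 0 := by
  classical
  rw [← Fintype.card_units] at h
  have : Fact (Nat.Prime 3) := ⟨Nat.prime_three⟩
  obtain ⟨u, hu⟩ := exists_prime_orderOf_dvd_card 3 h
  have hu3 : (u : K) ^ 3 = 1 := by
    rw [← Units.val_pow_eq_pow_val, ← hu, pow_orderOf_eq_one, Units.val_one]
  have hu1 : (u : K) - 1 ≠ 0 := by
    rw [sub_ne_zero, Ne, Units.val_eq_one]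
    rintro rfl
    simp at hu
  exact ⟨u, (mul_eq_zero.mp (by linear_combination hu3 :
    ((u : K) - 1) * (u ^ 2 + u + 1) = 0)).resolve_left hu1⟩

theorem exists_isPrimitive_addChar (K : Type*) [Field K] [Finite K] :
    ∃ θ : AddChar K ℂ, θ.IsPrimitive := by
  obtain ⟨θ, hθ⟩ := AddChar.exists_apply_ne_zero.mpr (one_ne_zero (α := K))
  refine ⟨θ, AddChar.IsPrimitive.of_ne_one ?_⟩
  rintro rfl
  simp at hθ

theorem sum_quadraticChar_cubic_eq {K : Type} [Field K] [Fintype K] [DecidableEq K]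
    (h2 : (2 : K) ≠ 0) (h3 : (3 : K) ≠ 0) {n : ℕ} (hn : Fintype.card K - 1 = 12 * n)
    {T : MulChar K ℂ} (hT : ∀ χ : MulChar K ℂ, ∃ n : ℕ, χ = T ^ n)
    {a b : K} (ha : a ≠ 0) (hb : b ≠ 0) (hΔ : 4 * a ^ 3 + 27 * b ^ 2 ≠ 0) :
    ∑ x : K, (quadraticChar K (x ^ 3 + a * x + b) : ℂ) =
      Fintype.card K * ((T ^ n) (1728 / (-16 * (4 * a ^ 3 + 27 * b ^ 2))) *
        hypF21 K T (T ^ n) (T ^ n) (T ^ (8 * n)) (4 * a ^ 3 / (4 * a ^ 3 + 27 * b ^ 2))) := by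
  obtain ⟨ω, hω⟩ := exists_sq_add_self_add_one_eq_zero (K := K) ⟨4 * n, by rw [hn]; ring⟩
  obtain ⟨θ, hθ⟩ := exists_isPrimitive_addChar K
  have hord := orderOf_of_forall_eq_pow hT
  rw [hn] at hord
  have hn0 : 0 < n := by
    have := Fintype.one_lt_card (α := K)
    omega
  have hA : (T ^ n) ^ 12 = 1 := by
    rw [← pow_mul, mul_comm, ← hord, pow_orderOf_eq_one]
  have hne : ∀ k, 0 < k → k < 12 → (T ^ n) ^ k ≠ 1 := by
    intro k hk hk' h
    rw [← pow_mul] at h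
    have := Nat.le_of_dvd (by positivity) (orderOf_dvd_of_pow_eq_one h)
    nlinarith
  rw [mul_comm 8 n, pow_mul, ← sum_cubic_eq_card_mul_hypF21 h2 h3 hω hT hA
    (hne 4 (by norm_num) (by norm_num)) (hne 6 (by norm_num) (by norm_num)) hθ ha hb hΔ]
  have hη2 : ((T ^ n) ^ 6) ^ 2 = 1 := by rw [← pow_mul, hA]
  exact sum_congr rfl fun x _ =>
    (MulChar.eq_quadraticChar (hne 6 (by norm_num) (by norm_num)) hη2 _).symm

theorem card_roots_quadratic {F : Type*} [Field F] [Fintype F] [DecidableEq F]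
    (h2 : ringChar F ≠ 2) {α : F} (hα : α ≠ 0) (β γ : F) :
    (#{X : F | α * X ^ 2 + 2 * β * X + γ = 0} : ℤ) = 1 + quadraticChar F (β ^ 2 - α * γ) := by
  rw [add_comm, ← quadraticChar_card_sqrts h2]
  norm_cast
  refine card_bij' (fun X _ => α * X + β) (fun Y _ => (Y - β) / α) ?_ ?_ ?_ ?_
  · intro X hX
    simp only [mem_filter, mem_univ, true_and] at hX
    simp only [Set.mem_toFinset, Set.mem_ofPred_eq]
    linear_combination α * hX
  · intro Y hY
    simp only [Set.mem_toFinset, Set.mem_ofPred_eq] at hY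
    simp only [mem_filter, mem_univ, true_and]
    field_simp
    linear_combination hY
  · intro X _
    field_simp
    ring
  · intro Y _
    field_simp
    ring

/-- The product of the values of `X ^ 3 + a * X + b` at two points, in terms of their sum `s` and
product `t`. -/
def cubicProd {F : Type*} [Field F] (a b s t : F) : F :=
  t ^ 3 + a * t * (s ^ 2 - 2 * t) + b * (s ^ 3 - 3 * s * t) + a ^ 2 * t + a * b * s + b ^ 2

theorem card_fiber_snd {F : Type*} [Field F] [Fintype F] [DecidableEq F]
    (h2 : ringChar F ≠ 2) {a b : F} (hΔ : 4 * a ^ 3 + 27 * b ^ 2 ≠ 0) (s t : F) :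
    (#{X : F | (a - t - s * X) ^ 2 = 4 * (s + X) * (b + t * X)} : ℤ) =
      quadraticChar F (cubicProd a b s t) + if s ^ 2 = 4 * t then 0 else 1 := by
  have h2' : (2 : F) ≠ 0 := Ring.two_ne_zero h2
  have h4 : (4 : F) = 2 ^ 2 := by norm_num
  have hχ4 : ∀ r : F, quadraticChar F (4 * r) = quadraticChar F r := fun r => by
    rw [map_mul, h4, quadraticChar_sq_one' h2', one_mul]
  have hset : ({X : F | (a - t - s * X) ^ 2 = 4 * (s + X) * (b + t * X)} : Finset F) =
      ({X : F | (s ^ 2 - 4 * t) * X ^ 2 + 2 * -(a * s + t * s + 2 * b) * X +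
        ((a - t) ^ 2 - 4 * s * b) = 0} : Finset F) := by
    ext X
    simp only [mem_filter, mem_univ, true_and]
    rw [← sub_eq_zero]
    ring_nf
  have hdisc : (-(a * s + t * s + 2 * b)) ^ 2 - (s ^ 2 - 4 * t) * ((a - t) ^ 2 - 4 * s * b) =
      4 * cubicProd a b s t := by
    rw [cubicProd]; ring
  rw [hset]
  split_ifs with h
  · have h0 : s ^ 2 - 4 * t = 0 := sub_eq_zero.mpr h
    rw [h0, zero_mul, sub_zero] at hdisc
    simp only [h0, zero_mul, zero_add, add_zero]
    rw [← hχ4, ← hdisc]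
    by_cases hl : -(a * s + t * s + 2 * b) = 0
    · rw [hl, zero_pow two_ne_zero, quadraticChar_zero, Nat.cast_eq_zero, card_eq_zero,
        filter_eq_empty_iff]
      intro X _ hX
      rw [mul_zero, zero_mul, zero_add] at hX
      apply hΔ
      obtain ⟨y, rfl⟩ : ∃ y, s = 2 * y := ⟨s / 2, (mul_div_cancel₀ s h2').symm⟩
      obtain rfl : t = y ^ 2 := by
        apply mul_left_cancel₀ (pow_ne_zero 2 h2')
        linear_combination -h
      obtain rfl : b = -(y ^ 3 + a * y) := by
        apply mul_left_cancel₀ h2'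
        linear_combination -hl
      have ha : (a + 3 * y ^ 2) ^ 2 = 0 := by
        linear_combination hX
      obtain rfl : a = -3 * y ^ 2 := by
        have : a + 3 * y ^ 2 = 0 := by simpa using ha
        linear_combination this
      ring
    · rw [quadraticChar_sq_one' hl]
      norm_cast
      rw [card_eq_one]
      refine ⟨-((a - t) ^ 2 - 4 * s * b) / (2 * -(a * s + t * s + 2 * b)), ?_⟩
      ext X
      simp only [mem_filter, mem_univ, true_and, mem_singleton]
      rw [eq_div_iff (mul_ne_zero h2' hl), ← sub_eq_zero (b := -_)]
      ring_nf
  · rw [card_roots_quadratic h2 (sub_ne_zero.mpr h), hdisc, hχ4, add_comm]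

theorem card_fiber_fst {F : Type*} [Field F] [Fintype F] [DecidableEq F]
    (h2 : (2 : F) ≠ 0) (a : F) {b : F} (hb : b ≠ 0) (X : F) :
    #{z : F × F | (a - z.2 - z.1 * X) ^ 2 = 4 * (z.1 + X) * (b + z.2 * X)} = Fintype.card F := by
  have h4 : (4 : F) ≠ 0 := by
    rw [show (4 : F) = 2 ^ 2 by norm_num]
    exact pow_ne_zero 2 h2
  rw [← card_univ]
  by_cases hX : X = 0
  · subst hX
    refine card_bij' (fun z _ => z.2) (fun t _ => ((a - t) ^ 2 / (4 * b), t)) ?_ ?_ ?_ ?_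
    · simp
    · intro t _
      simp only [mem_filter, mem_univ, true_and]
      field_simp
      ring
    · rintro ⟨s, t⟩ hz
      simp only [mem_filter, mem_univ, true_and] at hz
      simp only [Prod.mk.injEq, and_true]
      rw [div_eq_iff (mul_ne_zero h4 hb)]
      linear_combination hz
    · simp
  by_cases hF : X ^ 3 + a * X + b = 0
  · refine card_bij' (fun z _ => (z.1 + X) * X ^ 2)
      (fun n _ => (n / X ^ 2 - X, (n - b) / X)) ?_ ?_ ?_ ?_
    · simp
    · intro n _
      simp only [mem_filter, mem_univ, true_and]
      have e : a - (n - b) / X - (n / X ^ 2 - X) * X = (X ^ 3 + a * X + b - 2 * n) / X := by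
        field_simp
        ring
      rw [e, hF]
      field_simp
      ring
    · rintro ⟨s, t⟩ hz
      simp only [mem_filter, mem_univ, true_and] at hz
      have hz' : ((s + X) * X ^ 2 - b - t * X) ^ 2 = 0 := by
        linear_combination X ^ 2 * hz +
          (2 * ((s + X) * X ^ 2 + b + t * X) - (X ^ 3 + a * X + b)) * hF
      have : (s + X) * X ^ 2 - b - t * X = 0 := by simpa using hz'
      ext
      · field_simp
        ring
      · rw [div_eq_iff hX]
        linear_combination this
    · intro n _
      field_simp
      ring
  · obtain ⟨f, hf⟩ : ∃ f, f = X ^ 3 + a * X + b := ⟨_, rfl⟩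
    rw [← hf] at hF
    refine card_bij' (fun z _ => (z.1 + X) * X ^ 2 - b - z.2 * X)
      (fun m _ => ((m + f) ^ 2 / (4 * f) / X ^ 2 - X, ((m - f) ^ 2 / (4 * f) - b) / X)) ?_ ?_ ?_ ?_
    · simp
    · intro m _
      simp only [mem_filter, mem_univ, true_and]
      have ha : a = (f - X ^ 3 - b) / X := by
        rw [eq_div_iff hX, hf]
        ring
      rw [ha]
      field_simp
      ring
    · rintro ⟨s, t⟩ hz
      simp only [mem_filter, mem_univ, true_and] at hz
      have hu : ((s + X) * X ^ 2 - b - t * X + f) ^ 2 = (s + X) * X ^ 2 * (4 * f) := by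
        rw [hf]
        linear_combination X ^ 2 * hz
      have hv : ((s + X) * X ^ 2 - b - t * X - f) ^ 2 = (b + t * X) * (4 * f) := by
        rw [hf]
        linear_combination X ^ 2 * hz
      rw [hu, hv, mul_div_cancel_right₀ _ (mul_ne_zero h4 hF),
        mul_div_cancel_right₀ _ (mul_ne_zero h4 hF), mul_div_cancel_right₀ _ (pow_ne_zero 2 hX),
        add_sub_cancel_left, mul_div_cancel_right₀ _ hX, add_sub_cancel_right]
    · intro m _
      field_simp
      ring

theorem sum_quadraticChar_cubicProd {F : Type*} [Field F] [Fintype F] [DecidableEq F]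
    (h2 : ringChar F ≠ 2) {a b : F} (hb : b ≠ 0) (hΔ : 4 * a ^ 3 + 27 * b ^ 2 ≠ 0) :
    ∑ s : F, ∑ t : F, quadraticChar F (cubicProd a b s t) = Fintype.card F := by
  have h2' : (2 : F) ≠ 0 := Ring.two_ne_zero h2
  have h4 : (4 : F) ≠ 0 := by
    rw [show (4 : F) = 2 ^ 2 by norm_num]
    exact pow_ne_zero 2 h2'
  have hsq : ∀ s : F, ∑ t : F, (if s ^ 2 = 4 * t then 0 else 1 : ℤ) = Fintype.card F - 1 := by
    intro s
    have : ∀ t : F, (if s ^ 2 = 4 * t then 0 else 1 : ℤ) = 1 - if t = s ^ 2 / 4 then 1 else 0 := by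
      intro t
      simp only [eq_div_iff h4, eq_comm (a := s ^ 2), mul_comm t]
      split_ifs <;> rfl
    simp [this]
  have hN : ∑ s : F, ∑ t : F,
      (#{X : F | (a - t - s * X) ^ 2 = 4 * (s + X) * (b + t * X)} : ℤ) = Fintype.card F ^ 2 := by
    calc _ = ∑ X : F, (#{z : F × F |
          (a - z.2 - z.1 * X) ^ 2 = 4 * (z.1 + X) * (b + z.2 * X)} : ℤ) := by
          simp_rw [card_filter]
          push_cast
          rw [← Fintype.sum_prod_type', sum_comm]
      _ = _ := by
          simp_rw [card_fiber_fst h2' a hb]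
          simp [pow_two]
  simp_rw [card_fiber_snd h2 hΔ, sum_add_distrib, hsq] at hN
  rw [sum_const, card_univ, nsmul_eq_mul] at hN
  linear_combination hN

theorem quadraticChar_eq_of_pow_eq {p : ℕ} {F K : Type*} [Field F] [Fintype F] [DecidableEq F]
    [Field K] [Fintype K] [DecidableEq K] (hp : Odd p) (hF : Fintype.card F = p)
    (hK : Fintype.card K = p ^ 2) (hF2 : ringChar F ≠ 2) (hK2 : ringChar K ≠ 2) (φ : F →+* K)
    {y : K} {c : F} (h : y ^ (p + 1) = φ c) : quadraticChar K y = quadraticChar F c := by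
  refine Int.cast_injOn_of_ringChar_ne_two hK2
    (by simpa using quadraticChar_isQuadratic K y) (by simpa using quadraticChar_isQuadratic F c) ?_
  obtain ⟨k, rfl⟩ := hp
  have e1 : (2 * k + 1) ^ 2 / 2 = (2 * k + 1 + 1) * k := by
    rw [show (2 * k + 1) ^ 2 = 2 * ((2 * k + 1 + 1) * k) + 1 by ring]
    omega
  have e2 : (2 * k + 1) / 2 = k := by omega
  rw [quadraticChar_eq_pow_of_char_ne_two' hK2, hK, e1, pow_mul, h, ← map_intCast φ,
    quadraticChar_eq_pow_of_char_ne_two' hF2, hF, e2, map_pow]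

/-- In the quadratic extension `K` of a prime field `F`, a nonsquare `d` of `F` acquires a square
root. -/
theorem exists_sqrt_of_quadraticChar_eq_neg_one {p : ℕ} {F K : Type*} [Field F] [Fintype F]
    [DecidableEq F] [Field K] [Fintype K] [DecidableEq K] (hp : Odd p) (hF : Fintype.card F = p)
    (hK : Fintype.card K = p ^ 2) (hF2 : ringChar F ≠ 2) (hK2 : ringChar K ≠ 2) (φ : F →+* K)
    {d : F} (hd : quadraticChar F d = -1) : ∃ δ : K, δ ^ 2 = φ d ∧ δ ^ p = -δ := by
  have hd0 : d ≠ 0 := by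
    rintro rfl
    simp at hd
  have h1 : quadraticChar K (φ d) = 1 := by
    rw [quadraticChar_eq_of_pow_eq hp hF hK hF2 hK2 φ (c := d ^ 2), quadraticChar_sq_one' hd0]
    have := FiniteField.pow_card d
    rw [hF] at this
    rw [← map_pow, pow_succ, this, sq]
  rw [quadraticChar_one_iff_isSquare ((map_ne_zero φ).mpr hd0)] at h1
  obtain ⟨δ, hδ⟩ := h1
  rw [← sq] at hδ
  refine ⟨δ, hδ.symm, ?_⟩
  obtain ⟨k, hk⟩ := hp
  have e2 : p / 2 = k := by omega
  have h2 := quadraticChar_eq_pow_of_char_ne_two' hF2 d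
  rw [hd, hF, e2] at h2
  rw [hk, pow_succ, pow_mul, ← hδ, ← map_pow, ← h2]
  simp

theorem quadraticChar_add_mul_sqrt {p : ℕ} [Fact p.Prime] {F K : Type*} [Field F] [Fintype F]
    [DecidableEq F] [Field K] [Fintype K] [DecidableEq K] [CharP K p] (hp : Odd p)
    (hF : Fintype.card F = p) (hK : Fintype.card K = p ^ 2) (hF2 : ringChar F ≠ 2)
    (hK2 : ringChar K ≠ 2) (φ : F →+* K) {d : F} {δ : K} (hδ : δ ^ 2 = φ d) (hδp : δ ^ p = -δ)
    (P Q : F) : quadraticChar K (φ P + φ Q * δ) = quadraticChar F (P ^ 2 - d * Q ^ 2) := by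
  apply quadraticChar_eq_of_pow_eq hp hF hK hF2 hK2 φ
  have hfr : ∀ z : F, φ z ^ p = φ z := fun z => by
    rw [← map_pow, ← hF, FiniteField.pow_card]
  rw [pow_succ, add_pow_char, mul_pow, hfr, hfr, hδp]
  simp only [map_sub, map_mul, map_pow, ← hδ]
  ring

theorem bijective_add_mul_sqrt {F K : Type*} [Field F] [Fintype F]
    [DecidableEq F] [Field K] [Fintype K] (hK : Fintype.card K = Fintype.card F ^ 2)
    (φ : F →+* K) {d : F} (hd : quadraticChar F d = -1) {δ : K} (hδ : δ ^ 2 = φ d) :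
    Function.Bijective fun z : F × F => φ z.1 + φ z.2 * δ := by
  rw [Fintype.bijective_iff_injective_and_card]
  refine ⟨?_, by rw [Fintype.card_prod, hK, sq]⟩
  rintro ⟨u, v⟩ ⟨u', v'⟩ h
  simp only at h
  rw [quadraticChar_neg_one_iff_not_isSquare] at hd
  have hv : v = v' := by
    by_contra hv
    apply hd
    have hv' : v - v' ≠ 0 := sub_ne_zero.mpr hv
    refine ⟨(u' - u) / (v - v'), φ.injective ?_⟩
    have : δ = φ ((u' - u) / (v - v')) := by
      rw [map_div₀, eq_div_iff ((map_ne_zero φ).mpr hv'), map_sub, map_sub]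
      linear_combination h
    rw [← hδ, map_mul, ← this, sq]
  subst hv
  rw [φ.injective (add_right_cancel h)]

theorem sum_comp_sq_add_sum_comp_mul_sq {F : Type*} [Field F] [Fintype F] [DecidableEq F]
    (hF2 : ringChar F ≠ 2) {d : F} (hd : quadraticChar F d = -1) (h : F → ℤ) :
    ∑ v, h (v ^ 2) + ∑ v, h (d * v ^ 2) = 2 * ∑ w, h w := by
  have hd0 : d ≠ 0 := by
    rintro rfl
    simp at hd
  have key : ∀ g : F → ℤ, ∑ v, g (v ^ 2) = ∑ w, (quadraticChar F w + 1) * g w := fun g => by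
    rw [← sum_fiberwise_of_maps_to (s := univ) (t := univ) (g := fun v : F => v ^ 2)
      (fun _ _ => mem_univ _)]
    refine sum_congr rfl fun w _ => ?_
    rw [← quadraticChar_card_sqrts hF2, sum_congr rfl (g := fun _ => g w), sum_const, nsmul_eq_mul]
    · congr 3
      ext
      simp
    · intro v hv
      rw [(mem_filter.mp hv).2]
  rw [key h, key fun w => h (d * w), ← Equiv.sum_comp (Equiv.mulLeft₀ d hd0)
    (fun w => (quadraticChar F w + 1) * h w), ← sum_add_distrib, ← Equiv.sum_comp
    (Equiv.mulLeft₀ d hd0) h, mul_sum]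
  refine sum_congr rfl fun w _ => ?_
  simp only [Equiv.mulLeft₀_apply, map_mul, hd]
  ring

theorem sq_sum_quadraticChar_cubic {F : Type*} [Field F] [Fintype F] [DecidableEq F]
    (h2 : (2 : F) ≠ 0) (a b : F) :
    (∑ x, quadraticChar F (x ^ 3 + a * x + b)) ^ 2 =
      ∑ u, ∑ v, quadraticChar F (cubicProd a b (2 * u) (u ^ 2 - v ^ 2)) := by
  rw [sq, sum_mul_sum, ← Fintype.sum_prod_type', ← Fintype.sum_prod_type']
  refine sum_bij' (fun z _ => ((z.1 + z.2) / 2, (z.1 - z.2) / 2))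
    (fun z _ => (z.1 + z.2, z.1 - z.2)) (by simp) (by simp) ?_ ?_ ?_
  · rintro ⟨x, y⟩ _
    ext <;> field_simp <;> ring
  · rintro ⟨x, y⟩ _
    ext <;> field_simp <;> ring
  · rintro ⟨x, y⟩ _
    rw [← map_mul]
    congr 1
    simp only [cubicProd]
    field_simp
    ring

/-- The Weil relation between the traces of Frobenius of `y ^ 2 = x ^ 3 + a * x + b` over a prime
field and over its quadratic extension. -/
theorem sq_sum_quadraticChar_cubic_add {p : ℕ} [Fact p.Prime] {F K : Type*} [Field F] [Fintype F]
    [DecidableEq F] [Field K] [Fintype K] [DecidableEq K] [CharP K p] (hp : Odd p)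
    (hF : Fintype.card F = p) (hK : Fintype.card K = p ^ 2) (hF2 : ringChar F ≠ 2)
    (hK2 : ringChar K ≠ 2) (φ : F →+* K) {a b : F} (hb : b ≠ 0)
    (hΔ : 4 * a ^ 3 + 27 * b ^ 2 ≠ 0) :
    (∑ x, quadraticChar F (x ^ 3 + a * x + b)) ^ 2 +
      ∑ x, quadraticChar K (x ^ 3 + φ a * x + φ b) = 2 * p := by
  have h2 : (2 : F) ≠ 0 := Ring.two_ne_zero hF2
  obtain ⟨d, hd⟩ := quadraticChar_exists_neg_one hF2
  obtain ⟨δ, hδ, hδp⟩ := exists_sqrt_of_quadraticChar_eq_neg_one hp hF hK hF2 hK2 φ hd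
  have hSK : ∑ x, quadraticChar K (x ^ 3 + φ a * x + φ b) =
      ∑ u, ∑ v, quadraticChar F (cubicProd a b (2 * u) (u ^ 2 - d * v ^ 2)) := by
    rw [← (bijective_add_mul_sqrt (hF.symm ▸ hK) φ hd hδ).sum_comp, Fintype.sum_prod_type]
    refine sum_congr rfl fun u _ => sum_congr rfl fun v _ => ?_
    have e : (φ u + φ v * δ) ^ 3 + φ a * (φ u + φ v * δ) + φ b =
        φ (u ^ 3 + 3 * u * v ^ 2 * d + a * u + b) +
          φ (3 * u ^ 2 * v + v ^ 3 * d + a * v) * δ := by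
      simp only [map_add, map_mul, map_pow, ← hδ, map_ofNat]
      ring
    rw [e, quadraticChar_add_mul_sqrt hp hF hK hF2 hK2 φ hδ hδp]
    congr 1
    rw [cubicProd]
    ring
  rw [sq_sum_quadraticChar_cubic h2, hSK, ← sum_add_distrib, ← hF,
    ← sum_quadraticChar_cubicProd hF2 hb hΔ, mul_sum,
    ← Equiv.sum_comp (Equiv.mulLeft₀ (2 : F) h2)
      fun s => 2 * ∑ t, quadraticChar F (cubicProd a b s t)]
  refine sum_congr rfl fun u _ => ?_
  rw [sum_comp_sq_add_sum_comp_mul_sq hF2 hd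
    fun w => quadraticChar F (cubicProd a b (2 * u) (u ^ 2 - w)),
    ← Equiv.sum_comp (Equiv.subLeft (u ^ 2))]
  simp

theorem card_affine_points {F : Type*} [Field F] [Fintype F] [DecidableEq F]
    (hF2 : ringChar F ≠ 2) (f : F → F) :
    (Nat.card {xy : F × F // xy.2 ^ 2 = f xy.1} : ℤ) =
      Fintype.card F + ∑ x, quadraticChar F (f x) := by
  rw [Nat.card_congr (Equiv.subtypeProdEquivSigmaSubtype fun x y : F => y ^ 2 = f x),
    Nat.card_sigma, Nat.cast_sum, ← nsmul_one (Fintype.card F), ← card_univ, ← sum_const,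
    ← sum_add_distrib]
  refine sum_congr rfl fun x _ => ?_
  rw [add_comm, ← quadraticChar_card_sqrts hF2, Nat.card_eq_fintype_card, Set.toFinset_card]
  rfl

theorem twelve_dvd_sq_sub_one {p : ℕ} (hp : p.Prime) (h3 : 3 < p) : 12 ∣ p ^ 2 - 1 := by
  have hd2 : ¬ 2 ∣ p := fun h => by
    have := (Nat.prime_dvd_prime_iff_eq Nat.prime_two hp).mp h
    omega
  have hd3 : ¬ 3 ∣ p := fun h => by
    have := (Nat.prime_dvd_prime_iff_eq Nat.prime_three hp).mp h
    omega
  have h : p % 12 = 1 ∨ p % 12 = 5 ∨ p % 12 = 7 ∨ p % 12 = 11 := by omega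
  refine (Nat.modEq_iff_dvd' (Nat.one_le_pow _ _ hp.pos)).mp (Nat.ModEq.symm ?_)
  rcases h with h | h | h | h <;> simp [Nat.ModEq, Nat.pow_mod, h]

theorem stmt_17 (p : ℕ) [Fact p.Prime] (hp : 3 < p) (h12 : p % 12 ≠ 1)
    (F K : Type) [Field F] [Fintype F] [Field K] [Fintype K]
    (hF : Fintype.card F = p) (hK : Fintype.card K = p ^ 2)
    (φ : F →+* K)
    (a b : F) (ha : a ≠ 0) (hb : b ≠ 0) (hΔ : 4 * a ^ 3 + 27 * b ^ 2 ≠ 0)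
    (T : MulChar K ℂ) (hT : ∀ χ : MulChar K ℂ, ∃ n : ℕ, χ = T ^ n) :
    ((p : ℂ) + 1 -
        ((Nat.card {xy : F × F // xy.2 ^ 2 = xy.1 ^ 3 + a * xy.1 + b} + 1 : ℕ) : ℂ)) ^ 2 =
      (-(p : ℂ) ^ 2 *
          (T ^ ((p ^ 2 - 1) / 12)) (φ (1728 / (-16 * (4 * a ^ 3 + 27 * b ^ 2)))) *
          hypF21 K T (T ^ ((p ^ 2 - 1) / 12)) (T ^ ((p ^ 2 - 1) / 12))
            (T ^ (2 * ((p ^ 2 - 1) / 3)))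
            (φ (1728 * (4 * a ^ 3) / (4 * a ^ 3 + 27 * b ^ 2) / 1728))) +
        2 * (p : ℂ) := by
  classical
  have hpp : p.Prime := Fact.out
  have hF0 : CharP F p := by
    obtain ⟨q, hq⟩ := CharP.exists F
    obtain ⟨n, hqp, hn⟩ := FiniteField.card F q
    have : q = p := (Nat.prime_dvd_prime_iff_eq hqp hpp).mp
      (hF ▸ hn ▸ dvd_pow_self q n.ne_zero)
    rwa [← this]
  have hK0 : CharP K p := charP_of_injective_ringHom φ.injective p
  have hF2 : ringChar F ≠ 2 := by
    rw [ringChar.eq F p]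
    omega
  have hK2 : ringChar K ≠ 2 := by
    rw [ringChar.eq K p]
    omega
  have h2 : (2 : F) ≠ 0 := Ring.two_ne_zero hF2
  have h3 : (3 : F) ≠ 0 := fun h => by
    have := (CharP.cast_eq_zero_iff F p 3).mp (by exact_mod_cast h)
    have := Nat.le_of_dvd three_pos this
    omega
  obtain ⟨n, hn⟩ := twelve_dvd_sq_sub_one hpp hp
  have hn1 : (p ^ 2 - 1) / 12 = n := by omega
  have hn2 : 2 * ((p ^ 2 - 1) / 3) = 8 * n := by omega
  have h1728 : (1728 : F) ≠ 0 := by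
    rw [show (1728 : F) = 2 ^ 6 * 3 ^ 3 by norm_num]
    exact mul_ne_zero (pow_ne_zero _ h2) (pow_ne_zero _ h3)
  have hodd : Odd p := hpp.odd_of_ne_two (by omega)
  have hweil := sq_sum_quadraticChar_cubic_add hodd hF hK hF2 hK2 φ hb hΔ
  have hK3 : (3 : K) ≠ 0 := by simpa [map_ofNat] using (map_ne_zero φ).mpr h3
  have hΔK : 4 * φ a ^ 3 + 27 * φ b ^ 2 ≠ 0 := by
    simpa [map_ofNat] using (map_ne_zero φ).mpr hΔ
  have hyp := sum_quadraticChar_cubic_eq (Ring.two_ne_zero hK2) hK3 (hK ▸ hn) hT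
    ((map_ne_zero φ).mpr ha) ((map_ne_zero φ).mpr hb) hΔK
  have hcard := card_affine_points hF2 fun x => x ^ 3 + a * x + b
  have e1 : φ (1728 / (-16 * (4 * a ^ 3 + 27 * b ^ 2))) =
      1728 / (-16 * (4 * φ a ^ 3 + 27 * φ b ^ 2)) := by simp [map_ofNat]
  have e2 : φ (1728 * (4 * a ^ 3) / (4 * a ^ 3 + 27 * b ^ 2) / 1728) =
      4 * φ a ^ 3 / (4 * φ a ^ 3 + 27 * φ b ^ 2) := by
    rw [div_right_comm, mul_div_cancel_left₀ _ h1728]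
    simp [map_ofNat]
  rw [hn1, hn2, e1, e2]
  rw [hF] at hcard
  rw [hK, Nat.cast_pow] at hyp
  have hweil' := congrArg (Int.cast : ℤ → ℂ) hweil
  have hcard' := congrArg (Int.cast : ℤ → ℂ) hcard
  push_cast at hweil' hcard' ⊢
  rw [hcard']
  rw [hyp] at hweil'
  linear_combination hweil'
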